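/- arXiv:1805.02254 — 3 statements merged into one kernel-verified Lean document; each statement's English description precedes it below -/
import Mathlib

section
/- Let φ : ℝ → ℝ be a continuous mapping whose set of nonlinearity E(φ) has nonzero Lebesgue measure. Then there exist a set A ⊆ ℝ that contains arithmetic progressions of every length N (N = 1, 2, 3, ...) and a set B ⊆ ℝ with distinct sums of pairs such that φ maps A bijectively onto B. -/
open MeasureTheory Set

/-- A set `E ⊆ ℝ` has distinct sums of pairs. -/
def DistinctSumsOfPairs (E : Set ℝ) : Prop :=
  ∀ l₁ ∈ E, ∀ l₂ ∈ E, ∀ l₃ ∈ E, ∀ l₄ ∈ E,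
    l₁ + l₂ = l₃ + l₄ → (l₁ = l₃ ∧ l₂ = l₄) ∨ (l₁ = l₄ ∧ l₂ = l₃)

/-- The set of nonlinearity of `φ`: points having no open neighborhood
on which `φ` coincides with an affine function. -/
def NonlinSet (φ : ℝ → ℝ) : Set ℝ :=
  {t | ¬ ∃ ε > (0 : ℝ), ∃ p q : ℝ, ∀ u : ℝ, |u - t| < ε → φ u = p * u + q}

open Polynomial

/-- Goodness. -/
def GoodSet (φ : ℝ → ℝ) (A : Set ℝ) : Prop :=
  ∀ a ∈ A, ∀ b ∈ A, ∀ c ∈ A, ∀ d ∈ A, φ a + φ b = φ c + φ d → (a = c ∧ b = d) ∨ (a = d ∧ b = c)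

/-- Nondegenerate coefficient vectors. -/
def NonDeg (N : ℕ) (n : ℕ → ℝ) : Prop :=
  ¬ (∑ i ∈ Finset.Icc 1 N, n i = 0 ∧ ∑ i ∈ Finset.Icc 1 N, n i * i = 0 ∧
    ∑ i ∈ Finset.Icc 1 N, n i * (i:ℝ)^2 = 0)

/-- Arithmetic progressions avoiding finitely many relations. -/
def KeyProp (φ : ℝ → ℝ) : Prop :=
  ∀ (N : ℕ) (R : Finset ((ℕ → ℝ) × ℝ)), (∀ r ∈ R, NonDeg N r.1) →
    ∃ x y : ℝ, y ≠ 0 ∧ ∀ r ∈ R, ∑ i ∈ Finset.Icc 1 N, r.1 i * φ (x + i * y) ≠ r.2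

/-- coefficient -/
def cf : ℝ ⊕ ℕ → ℕ → ℝ
  | .inl _, _ => 0
  | .inr i, j => if j = i then 1 else 0

/-- constant -/
def cst (φ : ℝ → ℝ) : ℝ ⊕ ℕ → ℝ
  | .inl a => φ a
  | .inr _ => 0

/-- point -/
def pnt (x y : ℝ) : ℝ ⊕ ℕ → ℝ
  | .inl a => a
  | .inr i => x + i * y

lemma cf_sum (N : ℕ) (A : Finset ℝ) (e : ℝ ⊕ ℕ) (he : e ∈ A.disjSum (Finset.Icc 1 N)) (g : ℕ → ℝ) :
    ∑ i ∈ Finset.Icc 1 N, cf e i * g i = Sum.elim (fun _ => (0:ℝ)) g e := by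
  rcases e with a | i
  · simp [cf]
  · have : i ∈ Finset.Icc 1 N := by simpa using he
    simp only [cf, ite_mul, one_mul, zero_mul, Finset.sum_ite_eq', this, if_true, Sum.elim_inr]

lemma two_sq {a b c d : ℝ} (h1 : a + b = c + d) (h2 : a^2 + b^2 = c^2 + d^2) :
    (a = c ∧ b = d) ∨ (a = d ∧ b = c) := by
  have : (a - c) * (a - d) = 0 := by
    have : b = c + d - a := by linarith
    subst this; nlinarith
  rcases mul_eq_zero.1 this with h | h
  · left; constructor <;> linarith
  · right; constructor <;> linarith

lemma extend_good (φ : ℝ → ℝ) (hK : KeyProp φ) (A : Finset ℝ) (hA : GoodSet φ A) (N : ℕ) :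
    ∃ A' : Finset ℝ, A ⊆ A' ∧ GoodSet φ A' ∧ ∃ x y : ℝ, y ≠ 0 ∧
      ∀ k ∈ Finset.Icc 1 N, x + (k:ℝ) * y ∈ A' := by
  classical
  set Q := A.disjSum (Finset.Icc 1 N) with hQ
  let rel : (ℝ ⊕ ℕ) × (ℝ ⊕ ℕ) × (ℝ ⊕ ℕ) × (ℝ ⊕ ℕ) → (ℕ → ℝ) × ℝ := fun e =>
    (fun i => cf e.1 i + cf e.2.1 i - cf e.2.2.1 i - cf e.2.2.2 i,
      -(cst φ e.1 + cst φ e.2.1 - cst φ e.2.2.1 - cst φ e.2.2.2))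
  obtain ⟨x, y, hy, hxy⟩ := hK N (((Q ×ˢ Q ×ˢ Q ×ˢ Q).image rel).filter fun r => NonDeg N r.1)
    (fun r hr => (Finset.mem_filter.1 hr).2)
  refine ⟨Q.image (pnt x y), ?_, ?_, x, y, hy, ?_⟩
  · intro a ha
    exact Finset.mem_image.2 ⟨.inl a, by simpa [hQ] using ha, rfl⟩
  · intro a ha b hb c hc d hd habcd
    simp only [Finset.coe_image, Set.mem_image, Finset.mem_coe] at ha hb hc hd
    obtain ⟨e1, h1, rfl⟩ := ha
    obtain ⟨e2, h2, rfl⟩ := hb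
    obtain ⟨e3, h3, rfl⟩ := hc
    obtain ⟨e4, h4, rfl⟩ := hd
    have hsum : ∀ g : ℕ → ℝ, ∑ i ∈ Finset.Icc 1 N, (rel (e1, e2, e3, e4)).1 i * g i =
        Sum.elim (fun _ => (0:ℝ)) g e1 + Sum.elim (fun _ => (0:ℝ)) g e2
        - Sum.elim (fun _ => (0:ℝ)) g e3
        - Sum.elim (fun _ => (0:ℝ)) g e4 := by
      intro g
      rw [← cf_sum N A e1 h1 g, ← cf_sum N A e2 h2 g, ← cf_sum N A e3 h3 g, ← cf_sum N A e4 h4 g]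
      simp only [rel, sub_mul, add_mul, Finset.sum_sub_distrib, Finset.sum_add_distrib]
    have hnd : ¬ NonDeg N (rel (e1, e2, e3, e4)).1 := by
      intro hnd
      refine hxy (rel (e1, e2, e3, e4)) (Finset.mem_filter.2 ⟨Finset.mem_image.2
        ⟨(e1, e2, e3, e4), by simp only [Finset.mem_product]; exact ⟨h1, h2, h3, h4⟩, rfl⟩, hnd⟩) ?_
      rw [hsum fun i => φ (x + i * y)]
      rcases e1 with a1 | i1 <;> rcases e2 with a2 | i2 <;> rcases e3 with a3 | i3 <;>
        rcases e4 with a4 | i4 <;> simp only [rel, cst, pnt, Sum.elim_inl, Sum.elim_inr] at habcd ⊢ <;> linarith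
    unfold NonDeg at hnd
    rw [not_not] at hnd
    obtain ⟨m0, m1, m2⟩ := hnd
    have m0' := hsum (fun _ => 1)
    simp only [mul_one] at m0'
    rw [m0] at m0'
    rw [hsum fun i => (i:ℝ)] at m1
    rw [hsum fun i => (i:ℝ)^2] at m2
    clear hsum m0
    have hA' : ∀ a ∈ A, ∀ b ∈ A, φ a = φ b → a = b := by
      intro a ha b hb hab
      rcases hA a ha a ha b hb b hb (by linarith) with h | h <;> exact h.1
    rcases e1 with a1 | i1 <;> rcases e2 with a2 | i2 <;> rcases e3 with a3 | i3 <;>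
        rcases e4 with a4 | i4 <;> simp only [pnt, Sum.elim_inl, Sum.elim_inr] at habcd m0' m1 m2 ⊢ <;>
        simp only [hQ, Finset.inl_mem_disjSum, Finset.inr_mem_disjSum] at h1 h2 h3 h4 <;> norm_num at m0'
    · exact hA _ h1 _ h2 _ h3 _ h4 habcd
    · obtain rfl : i2 = i4 := by exact_mod_cast (by linarith : (i2:ℝ) = i4)
      exact Or.inl ⟨hA' _ h1 _ h3 (by linarith), rfl⟩
    · obtain rfl : i2 = i3 := by exact_mod_cast (by linarith : (i2:ℝ) = i3)
      exact Or.inr ⟨hA' _ h1 _ h4 (by linarith), rfl⟩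
    · obtain rfl : i1 = i4 := by exact_mod_cast (by linarith : (i1:ℝ) = i4)
      exact Or.inr ⟨rfl, hA' _ h2 _ h3 (by linarith)⟩
    · obtain rfl : i1 = i3 := by exact_mod_cast (by linarith : (i1:ℝ) = i3)
      exact Or.inl ⟨rfl, hA' _ h2 _ h4 (by linarith)⟩
    · rcases two_sq (by linarith : (i1:ℝ) + i2 = i3 + i4) (by linarith) with h | h
      · left; rw [h.1, h.2]; exact ⟨rfl, rfl⟩
      · right; rw [h.1, h.2]; exact ⟨rfl, rfl⟩
  · intro k hk
    exact Finset.mem_image.2 ⟨.inr k, by simpa [hQ] using hk, rfl⟩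

lemma main_of_key (φ : ℝ → ℝ) (hK : KeyProp φ) : ∃ A B : Set ℝ,
      (∀ N : ℕ, 1 ≤ N → ∃ x y : ℝ, y ≠ 0 ∧
        ∀ k ∈ Finset.Icc 1 N, x + (k : ℝ) * y ∈ A) ∧
      DistinctSumsOfPairs B ∧
      Set.BijOn φ A B := by
  classical
  choose! F hF1 hF2 hF3 using fun (A : Finset ℝ) (hA : GoodSet φ A) (N : ℕ) =>
    extend_good φ hK A hA N
  obtain ⟨S, hS0, hSs⟩ : ∃ S : ℕ → Finset ℝ, S 0 = ∅ ∧ ∀ n, S (n+1) = F (S n) (n+1) :=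
    ⟨fun n => Nat.rec ∅ (fun n A => F A (n+1)) n, rfl, fun n => rfl⟩
  have hS : ∀ n : ℕ, GoodSet φ (S n : Set ℝ) := by
    intro n
    induction n with
    | zero => rw [hS0]; intro a ha; simp at ha
    | succ n ih => rw [hSs]; exact hF2 (S n) ih (n+1)
  have hmono : Monotone S := monotone_nat_of_le_succ fun n => by
    rw [hSs]; exact hF1 (S n) (hS n) (n+1)
  set A : Set ℝ := ⋃ n, (S n : Set ℝ) with hAdef
  have hgood : GoodSet φ A := by
    intro a ha b hb c hc d hd
    rw [hAdef, Set.mem_iUnion] at ha hb hc hd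
    obtain ⟨i, ha⟩ := ha
    obtain ⟨j, hb⟩ := hb
    obtain ⟨k, hc⟩ := hc
    obtain ⟨l, hd⟩ := hd
    exact hS (i+j+k+l) a (hmono (by omega : i ≤ i+j+k+l) ha) b (hmono (by omega : j ≤ i+j+k+l) hb)
      c (hmono (by omega : k ≤ i+j+k+l) hc) d (hmono (by omega : l ≤ i+j+k+l) hd)
  refine ⟨A, φ '' A, ?_, ?_, ?_⟩
  · intro N hN
    obtain ⟨M, rfl⟩ : ∃ M, N = M + 1 := ⟨N - 1, by omega⟩
    obtain ⟨x, y, hy, h⟩ := hF3 (S M) (hS M) (M+1)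
    refine ⟨x, y, hy, fun k hk => Set.mem_iUnion.2 ⟨M+1, ?_⟩⟩
    rw [hSs]; exact h k hk
  · rintro _ ⟨a, ha, rfl⟩ _ ⟨b, hb, rfl⟩ _ ⟨c, hc, rfl⟩ _ ⟨d, hd, rfl⟩ h
    rcases hgood a ha b hb c hc d hd h with ⟨rfl, rfl⟩ | ⟨rfl, rfl⟩
    · exact Or.inl ⟨rfl, rfl⟩
    · exact Or.inr ⟨rfl, rfl⟩
  · refine Set.InjOn.bijOn_image ?_
    intro a ha b hb hab
    rcases hgood a ha a ha b hb b hb (by rw [hab]) with h | h <;> exact h.1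

lemma generic_avoid {φ : ℝ → ℝ} (hφ : Continuous φ) (N : ℕ) (U : Set (ℝ × ℝ)) (hU : IsOpen U)
    (hne : U.Nonempty) (R : Finset ((ℕ → ℝ) × ℝ))
    (h : ∀ r ∈ R, ∀ V ⊆ U, IsOpen V → V.Nonempty →
      ∃ z ∈ V, ∑ i ∈ Finset.Icc 1 N, r.1 i * φ (z.1 + i * z.2) ≠ r.2) :
    ∃ x y : ℝ, y ≠ 0 ∧ ∀ r ∈ R, ∑ i ∈ Finset.Icc 1 N, r.1 i * φ (x + i * y) ≠ r.2 := by
  classical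
  have key : ∃ V ⊆ U, IsOpen V ∧ V.Nonempty ∧ ∀ z ∈ V, ∀ r ∈ R,
      ∑ i ∈ Finset.Icc 1 N, r.1 i * φ (z.1 + i * z.2) ≠ r.2 := by
    induction R using Finset.induction_on with
    | empty => exact ⟨U, subset_rfl, hU, hne, by simp⟩
    | insert r R hr ih =>
      obtain ⟨V, hVU, hV, hVn, hz⟩ := ih fun r hr => h r (Finset.mem_insert_of_mem hr)
      obtain ⟨z, hzV, hzr⟩ := h r (Finset.mem_insert_self _ _) V hVU hV hVn
      refine ⟨V ∩ {z | ∑ i ∈ Finset.Icc 1 N, r.1 i * φ (z.1 + i * z.2) ≠ r.2},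
        inter_subset_left.trans hVU, hV.inter ?_, ⟨z, hzV, hzr⟩, ?_⟩
      · exact isOpen_ne_fun (by fun_prop) continuous_const
      · intro w hw s hs
        rcases Finset.mem_insert.1 hs with rfl | hs
        · exact hw.2
        · exact hz w hw.1 s hs
  obtain ⟨V, -, hV, ⟨z, hzV⟩, hVR⟩ := key
  obtain ⟨ε, hε, hb⟩ := Metric.isOpen_iff.1 hV z hzV
  obtain ⟨y, hy, hy0⟩ : ∃ y, dist y z.2 < ε ∧ y ≠ 0 := by
    by_cases h0 : z.2 = 0
    · exact ⟨ε/2, by rw [h0, Real.dist_eq, sub_zero, abs_of_pos (by positivity)]; linarith,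
        by positivity⟩
    · exact ⟨z.2, by simpa using hε, h0⟩
  exact ⟨z.1, y, hy0, fun r hr => hVR (z.1, y) (hb (by simp [Prod.dist_eq, hy])) r hr⟩

lemma exists_antideriv (m : ℕ) (G : ℝ[X]) (hG : G.degree < m) :
    ∃ P : ℝ[X], P.degree < (m+1 : ℕ) ∧ derivative P = G := by
  by_cases h0 : G = 0
  · exact ⟨0, by rw [degree_zero]; exact WithBot.bot_lt_coe _, by simp [h0]⟩
  have hnd : G.natDegree < m := (natDegree_lt_iff_degree_lt h0).2 hG
  refine ⟨∑ i ∈ Finset.range m, monomial (i+1) (G.coeff i / (i+1)), ?_, ?_⟩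
  · rw [← Polynomial.mem_degreeLT]
    refine Submodule.sum_mem _ fun i hi => ?_
    rw [Polynomial.mem_degreeLT]
    refine (degree_monomial_le _ _).trans_lt ?_
    have := Finset.mem_range.1 hi
    exact_mod_cast (by omega : i + 1 < m + 1)
  · rw [derivative_sum]
    conv_rhs => rw [Polynomial.as_sum_range' G m hnd]
    refine Finset.sum_congr rfl fun i _ => ?_
    rw [derivative_monomial]
    have : (i:ℝ)+1 ≠ 0 := by positivity
    simp [this]

lemma frechet_step (f : ℝ → ℝ) (hf : Continuous f) (u0 ρ δ : ℝ) (hρ : 0 < ρ) (hδ : 0 < δ) (m : ℕ)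
    (h : ∀ h, |h| < δ → ∃ p : ℝ[X], p.degree < m ∧ ∀ u, |u - u0| < ρ → f (u + h) - f u = p.eval u) :
    ∃ P : ℝ[X], P.degree < (m+1 : ℕ) ∧ ∀ u, |u - u0| < ρ → f u = P.eval u := by
  set d := δ / 2 with hd
  have hd0 : 0 < d := by positivity
  set v : ℕ → ℝ := fun j => u0 + ρ * (j / (m+1)) with hv
  have hm1 : (0:ℝ) < m + 1 := by positivity
  have hvb : ∀ j ∈ Finset.range m, |v j - u0| < ρ := by
    intro j hj
    have hj' : (j:ℝ) < m := by exact_mod_cast Finset.mem_range.1 hj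
    have : (j:ℝ) / (m+1) < 1 := by rw [div_lt_one hm1]; linarith
    have h0 : (0:ℝ) ≤ j / (m+1) := by positivity
    simp only [hv]
    rw [add_sub_cancel_left, abs_of_nonneg (by positivity)]
    nlinarith
  have hvi : Set.InjOn v (Finset.range m) := by
    intro i _ j _ hij
    simp only [hv] at hij
    have : ρ * ((i:ℝ) / (m+1)) = ρ * (j / (m+1)) := by linarith
    have := mul_left_cancel₀ hρ.ne' this
    field_simp at this
    exact_mod_cast this
  set Q : ℝ[X] := ∑ j ∈ Finset.range m,
    C (∫ h in (0:ℝ)..d, (f (v j + h) - f (v j))) * Lagrange.basis (Finset.range m) v j with hQ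
  have hQd : Q.degree < m := by
    have := Lagrange.degree_interpolate_lt (s := Finset.range m) (v := v)
      (fun j => ∫ h in (0:ℝ)..d, (f (v j + h) - f (v j))) hvi
    rw [Lagrange.interpolate_apply] at this
    simpa using this
  have hint : ∀ u, |u - u0| < ρ → (∫ h in (0:ℝ)..d, (f (u + h) - f u)) = Q.eval u := by
    intro u hu
    have e : ∀ h ∈ Set.uIcc 0 d, f (u + h) - f u =
        ∑ j ∈ Finset.range m, (f (v j + h) - f (v j)) * (Lagrange.basis (Finset.range m) v j).eval u := by
      intro t ht
      rw [Set.uIcc_of_le hd0.le] at ht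
      obtain ⟨p, hp, hpe⟩ := h t (by rw [abs_of_nonneg ht.1]; linarith [ht.2])
      rw [hpe u hu]
      have := Lagrange.eq_interpolate_of_eval_eq (s := Finset.range m) (v := v)
        (fun j => f (v j + t) - f (v j)) hvi (by simpa using hp)
        (fun j hj => (hpe (v j) (hvb j hj)).symm)
      rw [Lagrange.interpolate_apply] at this
      conv_lhs => rw [this]
      simp [eval_finsetSum]
    rw [intervalIntegral.integral_congr e, intervalIntegral.integral_finsetSum]
    · simp [hQ, eval_finsetSum]
    · intro j _
      apply Continuous.intervalIntegrable
      fun_prop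
  set F : ℝ → ℝ := fun u => ∫ t in (0:ℝ)..u, f t with hF
  have hFd : ∀ u, HasDerivAt F (f u) u := fun u =>
    intervalIntegral.integral_hasDerivAt_right (hf.intervalIntegrable _ _)
      hf.stronglyMeasurable.stronglyMeasurableAtFilter hf.continuousAt
  have hfu : ∀ u, |u - u0| < ρ → f u = (F (u + d) - F u - Q.eval u) / d := by
    intro u hu
    rw [← hint u hu, intervalIntegral.integral_sub, intervalIntegral.integral_const,
      intervalIntegral.integral_comp_add_left (fun x => f x)]
    · have : F (u + d) - F u = ∫ t in (u + 0)..(u + d), f t := by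
        rw [add_zero]
        exact intervalIntegral.integral_interval_sub_left (hf.intervalIntegrable _ _)
          (hf.intervalIntegrable _ _)
      rw [this]
      simp
      field_simp
    · apply Continuous.intervalIntegrable
      fun_prop
    · apply Continuous.intervalIntegrable
      fun_prop
  obtain ⟨p, hp, hpe⟩ := h d (by rw [abs_of_pos hd0]; linarith)
  set G : ℝ[X] := (1/d) • (p - derivative Q) with hG
  have hGd : G.degree < m := by
    rw [← Polynomial.mem_degreeLT] at *
    refine Submodule.smul_mem _ _ (Submodule.sub_mem _ hp ?_)
    rw [Polynomial.mem_degreeLT] at *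
    exact (degree_derivative_le).trans_lt hQd
  obtain ⟨P, hPd, hPG⟩ := exists_antideriv m G hGd
  have hopen : IsOpen {u : ℝ | |u - u0| < ρ} := by
    apply isOpen_lt <;> fun_prop
  have hfd : ∀ u, |u - u0| < ρ → HasDerivAt f (G.eval u) u := by
    intro u hu
    have h1 : HasDerivAt (fun u => (F (u + d) - F u - Q.eval u) / d)
        ((f (u + d) - f u - (derivative Q).eval u) / d) u :=
      ((((hFd (u+d)).comp_add_const u d).sub (hFd u)).sub (Q.hasDerivAt u)).div_const d
    have h2 : G.eval u = ((f (u + d) - f u - (derivative Q).eval u) / d) := by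
      rw [hpe u hu]; simp [hG]; field_simp
    rw [h2]
    refine h1.congr_of_eventuallyEq ?_
    filter_upwards [hopen.mem_nhds hu] with w hw using hfu w hw
  refine ⟨P + C (f u0 - P.eval u0), ?_, ?_⟩
  · refine (degree_add_le _ _).trans_lt (max_lt hPd (degree_C_le.trans_lt ?_))
    exact_mod_cast Nat.succ_pos m
  · intro u hu
    have hconv : Convex ℝ {u : ℝ | |u - u0| < ρ} := by
      have : {u : ℝ | |u - u0| < ρ} = Metric.ball u0 ρ := by
        ext; simp [Real.dist_eq]
      rw [this]; exact convex_ball _ _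
    have hD : ∀ u, |u - u0| < ρ → HasDerivAt (fun u => f u - P.eval u) 0 u := by
      intro u hu
      have := (hfd u hu).sub (P.hasDerivAt u)
      rw [hPG, sub_self] at this
      exact this
    have := hopen.is_const_of_deriv_eq_zero hconv.isPreconnected
      (fun x hx => (hD x hx).differentiableAt.differentiableWithinAt)
      (fun x hx => (hD x hx).deriv) hu (by simpa using hρ : u0 ∈ {u : ℝ | |u - u0| < ρ})
    simp only [eval_add, eval_C]
    linarith

lemma frechet_local (k : ℕ) (t : Finset ℕ) : k ∉ t → ∀ r > (0:ℝ), ∃ ρ > (0:ℝ),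
    ∀ (f : ℕ → ℝ → ℝ), (∀ i, Continuous (f i)) → ∀ c x0 y0 : ℝ,
    (∀ x y, |x - x0| < r → |y - y0| < r → ∑ i ∈ insert k t, f i (x + i * y) = c) →
    ∃ p : ℝ[X], p.degree < (t.card + 1 : ℕ) ∧ ∀ u, |u - (x0 + k * y0)| < ρ → f k u = p.eval u := by
  induction t using Finset.induction_on with
  | empty =>
    intro _ r hr
    refine ⟨r, hr, fun f hf c x0 y0 h => ⟨C c, ?_, fun u hu => ?_⟩⟩
    · exact degree_C_le.trans_lt (by simp)
    · have := h (u - k * y0) y0 (by convert hu using 2; ring) (by simpa using hr)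
      simpa using this
  | insert j t hj ih =>
    intro hk r hr
    have hkj : k ≠ j := fun e => hk (by simp [e])
    have hkt : k ∉ t := fun e => hk (by simp [e])
    obtain ⟨ρ, hρ, H⟩ := ih hkt (r/2) (by positivity)
    refine ⟨ρ, hρ, fun f hf c x0 y0 h => ?_⟩
    rw [Finset.card_insert_of_notMem hj]
    have he : (k:ℝ) - j ≠ 0 := sub_ne_zero.2 (by exact_mod_cast hkj)
    have hj1 : (0:ℝ) < j + 1 := by positivity
    refine frechet_step (f k) (hf k) _ ρ (|(k:ℝ) - j| * (r / 2 / (j+1))) hρ (by positivity) _ ?_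
    intro s hs
    set τ := s / ((k:ℝ) - j) with hτ
    have hτ' : |τ| < r / 2 / (j+1) := by
      rw [hτ, abs_div, div_lt_iff₀ (by positivity)]; linarith
    have hτ2 : |τ| * (j+1) < r/2 := by rwa [lt_div_iff₀ hj1] at hτ'
    have hτ0 := abs_nonneg τ
    have hτj : |j * τ| < r / 2 := by rw [abs_mul, Nat.abs_cast]; nlinarith
    have hτ1 : |τ| < r / 2 := by nlinarith [(Nat.cast_nonneg j : (0:ℝ) ≤ j)]
    have hrel : ∀ x y, |x - x0| < r / 2 → |y - y0| < r / 2 → ∑ i ∈ insert k t,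
        (f i (x + i * y + ((i:ℝ) - j) * τ) - f i (x + i * y)) = 0 := by
      intro x y hx hy
      rw [abs_lt] at hx hy hτj hτ1
      have h1 := h x y (abs_lt.2 ⟨by linarith, by linarith⟩) (abs_lt.2 ⟨by linarith, by linarith⟩)
      have h2 := h (x - j * τ) (y + τ) (abs_lt.2 ⟨by linarith, by linarith⟩)
        (abs_lt.2 ⟨by linarith, by linarith⟩)
      rw [Finset.insert_comm, Finset.sum_insert (by simp [hkj.symm, hj])] at h1 h2
      rw [Finset.sum_sub_distrib]
      have e1 : x - j * τ + j * (y + τ) = x + j * y := by ring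
      have e2 : ∀ i : ℕ, x - j * τ + i * (y + τ) = x + i * y + ((i:ℝ) - j) * τ := by intro i; ring
      rw [e1] at h2
      simp only [e2] at h2
      linarith
    obtain ⟨p, hp, hpe⟩ := H (fun i u => f i (u + ((i:ℝ) - j) * τ) - f i u)
      (fun i => by have := hf i; fun_prop) 0 x0 y0 hrel
    refine ⟨p, hp, fun u hu => ?_⟩
    rw [← hpe u hu]
    simp only [hτ]
    rw [mul_div_cancel₀ _ he]

lemma NonDeg.exists_ne {N : ℕ} {n : ℕ → ℝ} (h : NonDeg N n) : ∃ k ∈ Finset.Icc 1 N, n k ≠ 0 := by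
  by_contra hc
  push Not at hc
  refine h ⟨Finset.sum_eq_zero hc, Finset.sum_eq_zero fun i hi => ?_,
    Finset.sum_eq_zero fun i hi => ?_⟩ <;> rw [hc i hi, zero_mul]

lemma in_interval {w ρ x y : ℝ} (N i : ℕ) (hx : |x - w| < ρ / 2) (hy : |y| < ρ / 2 / (N + 1))
    (hi : i ∈ Finset.Icc 1 N) : |x + i * y - w| < ρ := by
  have hN : (0:ℝ) < N + 1 := by positivity
  rw [lt_div_iff₀ hN] at hy
  have hi' : (i:ℝ) ≤ N := by exact_mod_cast (Finset.mem_Icc.1 hi).2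
  have h1 : |(i:ℝ) * y| < ρ / 2 := by
    rw [abs_mul, Nat.abs_cast]
    nlinarith [abs_nonneg y]
  rw [abs_lt] at *
  constructor <;> linarith

lemma key_of_box {φ : ℝ → ℝ} (hφ : Continuous φ) (w ρ : ℝ) (hρ : 0 < ρ)
    (H : ∀ (N : ℕ) (n : ℕ → ℝ) (c : ℝ), NonDeg N n → ∀ x0 y0 ε : ℝ, 0 < ε →
      (∀ x y, |x - x0| < ε → |y - y0| < ε → ∀ i ∈ Finset.Icc 1 N, |x + i * y - w| < ρ) →
      (∀ x y, |x - x0| < ε → |y - y0| < ε → ∑ i ∈ Finset.Icc 1 N, n i * φ (x + i * y) = c) →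
      False) : KeyProp φ := by
  intro N R hR
  have hN : (0:ℝ) < N + 1 := by positivity
  refine generic_avoid hφ N {z | |z.1 - w| < ρ / 2 ∧ |z.2| < ρ / 2 / (N + 1)} ?_ ?_ R ?_
  · have o1 : IsOpen {z : ℝ × ℝ | |z.1 - w| < ρ / 2} := isOpen_lt (by fun_prop) continuous_const
    have o2 : IsOpen {z : ℝ × ℝ | |z.2| < ρ / 2 / (N + 1)} := isOpen_lt (by fun_prop) continuous_const
    exact o1.inter o2
  · exact ⟨(w, 0), by simpa using hρ, by simp only [abs_zero]; positivity⟩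
  · intro r hr V hVU hV ⟨z, hz⟩
    by_contra hc
    push Not at hc
    obtain ⟨ε, hε, hb⟩ := Metric.isOpen_iff.1 hV z hz
    have hmem : ∀ x y, |x - z.1| < ε → |y - z.2| < ε → (x, y) ∈ V := fun x y hx hy =>
      hb (by rw [Metric.mem_ball, Prod.dist_eq]; exact max_lt hx hy)
    refine H N r.1 r.2 (hR r hr) z.1 z.2 ε hε (fun x y hx hy i hi => ?_)
      (fun x y hx hy => hc _ (hmem x y hx hy))
    have := hVU (hmem x y hx hy)
    exact in_interval N i this.1 this.2 hi

lemma infinite_interval (a ε : ℝ) (hε : 0 < ε) : {u : ℝ | |u - a| < ε}.Infinite := by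
  have : {u : ℝ | |u - a| < ε} = Set.Ioo (a - ε) (a + ε) := by
    ext u; simp only [mem_ofPred_eq, abs_lt, mem_Ioo]; constructor <;> intro h <;> constructor <;> linarith [h.1, h.2]
  rw [this]
  exact Set.Ioo_infinite (by linarith)

lemma key_poly {φ : ℝ → ℝ} (hφ : Continuous φ) (p : ℝ[X]) (hp : 2 ≤ p.natDegree) (w ρ : ℝ)
    (hρ : 0 < ρ) (h : ∀ u, |u - w| < ρ → φ u = p.eval u) : KeyProp φ := by
  refine key_of_box hφ w ρ hρ ?_
  intro N n c hnd x0 y0 ε hε hin hrel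
  have hzero : ∀ x, |x - x0| < ε →
      ∑ i ∈ Finset.Icc 1 N, C (n i) * p.comp (C x + C (i:ℝ) * X) - C c = 0 := by
    intro x hx
    refine eq_zero_of_infinite_isRoot _ ((infinite_interval y0 ε hε).mono ?_)
    intro y hy
    have := hrel x y hx hy
    rw [mem_ofPred_eq, IsRoot.def]
    simp only [eval_sub, eval_finsetSum, eval_mul, eval_C, eval_comp, eval_add, eval_X]
    rw [← this, sub_eq_zero]
    refine Finset.sum_congr rfl fun i hi => ?_
    rw [h _ (hin x y hx hy i hi)]
  have hd1 : ∀ x i, derivative (C (n i) * p.comp (C x + C (i:ℝ) * X)) =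
      C (n i * i) * (derivative p).comp (C x + C (i:ℝ) * X) := by
    intro x i
    simp [derivative_comp]
    ring
  have hd2 : ∀ x i, derivative (C (n i * i) * (derivative p).comp (C x + C (i:ℝ) * X)) =
      C (n i * (i:ℝ)^2) * (derivative (derivative p)).comp (C x + C (i:ℝ) * X) := by
    intro x i
    simp [derivative_comp]
    ring
  have e0 : ∀ x, |x - x0| < ε → (∑ i ∈ Finset.Icc 1 N, n i) * p.eval x = c := by
    intro x hx
    have := congrArg (eval 0) (hzero x hx)
    simp [eval_finsetSum, ← Finset.sum_mul] at this
    linarith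
  have e1 : ∀ x, |x - x0| < ε →
      (∑ i ∈ Finset.Icc 1 N, n i * i) * (derivative p).eval x = 0 := by
    intro x hx
    have := congrArg (fun q => eval 0 (derivative q)) (hzero x hx)
    simp only [derivative_sub, derivative_sum, hd1] at this
    simpa [eval_finsetSum, ← Finset.sum_mul] using this
  have e2 : ∀ x, |x - x0| < ε →
      (∑ i ∈ Finset.Icc 1 N, n i * (i:ℝ)^2) * (derivative (derivative p)).eval x = 0 := by
    intro x hx
    have := congrArg (fun q => eval 0 (derivative (derivative q))) (hzero x hx)
    simp only [derivative_sub, derivative_sum, hd1, hd2] at this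
    simpa [eval_finsetSum, ← Finset.sum_mul] using this
  have hn1 : (derivative p).natDegree = p.natDegree - 1 := natDegree_derivative p
  have hn2 : derivative (derivative p) ≠ 0 := by
    intro h0
    have := derivative_eq_zero.1 h0
    omega
  have hn1' : derivative p ≠ 0 := by
    intro h0
    rw [h0, natDegree_zero] at hn1; omega
  have aux : ∀ (S : ℝ) (q : ℝ[X]), q ≠ 0 → (∀ x, |x - x0| < ε → S * q.eval x = 0) → S = 0 := by
    intro S q hq hS
    by_contra hS0
    refine hq (eq_zero_of_infinite_isRoot _ ((infinite_interval x0 ε hε).mono ?_))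
    intro x hx
    exact (mul_eq_zero.1 (hS x hx)).resolve_left hS0
  refine hnd ⟨?_, aux _ _ hn1' e1, aux _ _ hn2 e2⟩
  by_contra hS
  have hq : p - C (c / ∑ i ∈ Finset.Icc 1 N, n i) = 0 := by
    refine eq_zero_of_infinite_isRoot _ ((infinite_interval x0 ε hε).mono ?_)
    intro x hx
    rw [mem_ofPred_eq, IsRoot.def, eval_sub, eval_C, ← e0 x hx]
    field_simp
    ring
  rw [sub_eq_zero.1 hq, natDegree_C] at hp
  omega

lemma key_interior {φ : ℝ → ℝ} (hφ : Continuous φ) (hI : (interior (NonlinSet φ)).Nonempty) :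
    KeyProp φ := by
  obtain ⟨w, hw⟩ := hI
  obtain ⟨ρ, hρ, hb⟩ := Metric.isOpen_iff.1 isOpen_interior w hw
  have hE : ∀ u, |u - w| < ρ → u ∈ NonlinSet φ := fun u hu => interior_subset (hb hu)
  by_cases hpoly : ∃ u0, |u0 - w| < ρ ∧ ∃ ρ' > 0, ∃ p : ℝ[X], ∀ u, |u - u0| < ρ' → φ u = p.eval u
  · obtain ⟨u0, hu0, ρ', hρ', p, hp⟩ := hpoly
    refine key_poly hφ p ?_ u0 ρ' hρ' hp
    by_contra hlt
    refine hE u0 hu0 ⟨ρ', hρ', p.coeff 1, p.coeff 0, fun u hu => ?_⟩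
    rw [hp u hu]
    conv_lhs => rw [eq_X_add_C_of_natDegree_le_one (by omega : p.natDegree ≤ 1)]
    simp
  · push Not at hpoly
    refine key_of_box hφ w ρ hρ ?_
    intro N n c hnd x0 y0 ε hε hin hrel
    obtain ⟨k, hk, hnk⟩ := hnd.exists_ne
    obtain ⟨ρ', hρ', H⟩ := frechet_local k ((Finset.Icc 1 N).erase k) (by simp) ε hε
    obtain ⟨p, -, hp⟩ := H (fun i u => n i * φ u) (fun i => by fun_prop) c x0 y0 (by
      rw [Finset.insert_erase hk]; exact hrel)
    obtain ⟨u, hu, hne⟩ := hpoly (x0 + k * y0) (hin x0 y0 (by simpa using hε) (by simpa using hε) k hk)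
      ρ' hρ' (C (n k)⁻¹ * p)
    apply hne
    rw [eval_mul, eval_C, ← hp u hu]
    field_simp

lemma avoid_lines {φ : ℝ → ℝ} (hφ : Continuous φ) (hd : Dense (NonlinSet φ)ᶜ) (v0 η : ℝ)
    (hinf : (NonlinSet φ ∩ {v | |v - v0| < η}).Infinite) (Fb : Finset (ℝ × ℝ)) :
    ∃ v p q ε : ℝ, |v - v0| < η ∧ 0 < ε ∧ (p, q) ∉ Fb ∧ ∀ u, |u - v| < ε → φ u = p * u + q := by
  by_contra hc
  push Not at hc
  have hopen : IsOpen {v : ℝ | |v - v0| < η} := isOpen_lt (by fun_prop) continuous_const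
  have hcov : ∀ v, |v - v0| < η → ∃ L ∈ Fb, φ v = L.1 * v + L.2 := by
    have hcl : IsClosed (⋃ L ∈ Fb, {v : ℝ | φ v = L.1 * v + L.2}) :=
      isClosed_biUnion_finset fun L _ => isClosed_eq hφ (by fun_prop)
    have hsub : {v : ℝ | |v - v0| < η} ⊆ ⋃ L ∈ Fb, {v : ℝ | φ v = L.1 * v + L.2} := by
      refine (hd.open_subset_closure_inter hopen).trans (closure_minimal ?_ hcl)
      rintro v ⟨hv, hvE⟩
      simp only [NonlinSet, mem_compl_iff, mem_ofPred_eq, not_not] at hvE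
      obtain ⟨ε, hε, p, q, h⟩ := hvE
      have hmem : (p, q) ∈ Fb := by
        by_contra hn
        obtain ⟨u, hu, hne⟩ := hc v p q ε hv hε hn
        exact hne (h u hu)
      simp only [mem_iUnion]
      exact ⟨(p, q), hmem, h v (by simpa using hε)⟩
    intro v hv
    have := hsub hv
    simp only [mem_iUnion] at this
    obtain ⟨L, hL, h⟩ := this
    exact ⟨L, hL, h⟩
  have hX : (⋃ L ∈ Fb, ⋃ L' ∈ Fb, {v : ℝ | L ≠ L' ∧ L.1 * v + L.2 = L'.1 * v + L'.2}).Finite := by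
    refine Fb.finite_toSet.biUnion fun L _ => Fb.finite_toSet.biUnion fun L' _ => ?_
    refine Set.Subsingleton.finite ?_
    rintro a ⟨hne, ha⟩ b ⟨-, hb⟩
    have h1 : (L.1 - L'.1) * (a - b) = 0 := by linarith
    rcases mul_eq_zero.1 h1 with h | h
    · refine absurd (Prod.ext (by linarith) ?_) hne
      have : L.1 = L'.1 := by linarith
      rw [this] at ha; linarith
    · linarith
  obtain ⟨v, ⟨hvE, hv⟩, hvX⟩ := (hinf.sdiff hX).nonempty
  obtain ⟨L, hL, hLv⟩ := hcov v hv
  have hev : ∀ᶠ u in nhds v, ∀ L' ∈ Fb, L' ≠ L → φ u ≠ L'.1 * u + L'.2 := by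
    rw [Filter.eventually_all_finset]
    intro L' hL'
    by_cases hne : L' = L
    · exact Filter.Eventually.of_forall fun u h => absurd hne h
    · have hvne : φ v ≠ L'.1 * v + L'.2 := by
        intro he
        apply hvX
        simp only [mem_iUnion]
        exact ⟨L, hL, L', hL', fun h => hne h.symm, by linarith⟩
      have : IsOpen {u | φ u ≠ L'.1 * u + L'.2} := isOpen_ne_fun hφ (by fun_prop)
      filter_upwards [this.mem_nhds hvne] with u hu _ using hu
  obtain ⟨ε, hε, hball⟩ := Metric.eventually_nhds_iff.1 (hev.and (hopen.mem_nhds hv))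
  refine hvE ⟨ε, hε, L.1, L.2, fun u hu => ?_⟩
  obtain ⟨h1, h2⟩ := hball (y := u) (by rwa [Real.dist_eq])
  obtain ⟨L', hL', he⟩ := hcov u h2
  by_cases hne : L' = L
  · rw [← hne]; exact he
  · exact absurd he (h1 L' hL' hne)

open scoped ENNReal Topology in
lemma density_set (E : Set ℝ) (hE : MeasurableSet E) : ∃ D ⊆ E, volume (E \ D) = 0 ∧
    ∀ (s : Finset ℕ) (t c : ℕ → ℝ), (∀ i ∈ s, t i ∈ D) → (∀ i ∈ s, c i ≠ 0) →
    ∃ η0 > (0:ℝ), ∀ η, 0 < η → η < η0 → ∀ v, |v| < η → ∃ y, |y| < η ∧ ∀ i ∈ s, t i + v + c i * y ∈ D := by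
  set D : Set ℝ := {x | x ∈ E ∧ Filter.Tendsto (fun r => volume (Eᶜ ∩ Metric.closedBall x r) /
    volume (Metric.closedBall x r)) (𝓝[>] 0) (𝓝 0)} with hD
  have hnull : volume (E \ D) = 0 := by
    have := Besicovitch.ae_tendsto_measure_inter_div_of_measurableSet (volume : Measure ℝ) hE.compl
    refine measure_mono_null ?_ (ae_iff.1 this)
    rintro x ⟨hx, hxD⟩ hT
    apply hxD
    refine ⟨hx, ?_⟩
    simpa [hx] using hT
  refine ⟨D, fun x hx => hx.1, hnull, ?_⟩
  intro s t c ht hc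
  set ε : ℕ → ℝ := fun i => |c i| / ((1 + |c i|) * (s.card + 1)) with hε
  have hev : ∀ᶠ η in 𝓝[>] (0:ℝ), ∀ i ∈ s, volume (Dᶜ ∩ Metric.closedBall (t i) ((1 + |c i|) * η)) ≤
      ENNReal.ofReal (ε i) * ENNReal.ofReal (2 * ((1 + |c i|) * η)) := by
    rw [Filter.eventually_all_finset]
    intro i hi
    have hci : 0 < |c i| := abs_pos.2 (hc i hi)
    have hεi : 0 < ε i := by simp only [hε]; positivity
    have hT := (ht i hi).2
    have hscale : Filter.Tendsto (fun η : ℝ => (1 + |c i|) * η) (𝓝[>] 0) (𝓝[>] 0) := by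
      refine tendsto_nhdsWithin_iff.2 ⟨?_, ?_⟩
      · have : Filter.Tendsto (fun η : ℝ => (1 + |c i|) * η) (𝓝 0) (𝓝 ((1 + |c i|) * 0)) :=
          (continuous_const.mul continuous_id).tendsto 0
        rw [mul_zero] at this
        exact this.mono_left nhdsWithin_le_nhds
      · filter_upwards [self_mem_nhdsWithin] with η hη
        have : (0:ℝ) < η := hη
        show (0:ℝ) < _
        positivity
    have h2 := (hT.comp hscale).eventually_lt_const (u := ENNReal.ofReal (ε i))
      (by simpa using hεi)
    filter_upwards [h2, self_mem_nhdsWithin] with η hη hη0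
    have hη0' : (0:ℝ) < η := hη0
    simp only [Function.comp, Real.volume_closedBall] at hη
    have hpos : 0 < 2 * ((1 + |c i|) * η) := by positivity
    have h3 := (ENNReal.div_le_iff (by simpa using hpos.ne'.symm.lt_of_le hpos.le) ENNReal.ofReal_ne_top).1 hη.le
    refine le_trans ?_ h3
    calc volume (Dᶜ ∩ Metric.closedBall (t i) ((1 + |c i|) * η))
        ≤ volume ((Eᶜ ∩ Metric.closedBall (t i) ((1 + |c i|) * η)) ∪ (E \ D)) := by
          apply measure_mono
          rintro x ⟨hx, hxb⟩
          by_cases hxE : x ∈ E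
          · exact Or.inr ⟨hxE, hx⟩
          · exact Or.inl ⟨hxE, hxb⟩
      _ ≤ _ := (measure_union_le _ _).trans (by rw [hnull, add_zero])
  obtain ⟨η0, hη0, hsub⟩ := mem_nhdsGT_iff_exists_Ioo_subset.1 hev
  refine ⟨η0, hη0, fun η hη hηlt v hv => ?_⟩
  have hb := hsub ⟨hη, hηlt⟩
  simp only [mem_ofPred_eq] at hb
  by_contra hcon
  push Not at hcon
  have hcover : Set.Ioo (-η) η ⊆ ⋃ i ∈ s, (fun y => c i * y) ⁻¹' ((fun z => (t i + v) + z) ⁻¹'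
      (Dᶜ ∩ Metric.closedBall (t i) ((1 + |c i|) * η))) := by
    intro y hy
    have hy' : |y| < η := abs_lt.2 hy
    obtain ⟨i, hi, hn⟩ := hcon y hy'
    simp only [mem_iUnion]
    refine ⟨i, hi, hn, ?_⟩
    rw [Metric.mem_closedBall, Real.dist_eq]
    have : t i + v + c i * y - t i = v + c i * y := by ring
    rw [this]
    refine (abs_add_le _ _).trans ?_
    rw [abs_mul]
    nlinarith [abs_nonneg (c i)]
  have hle : ENNReal.ofReal (2 * η) ≤ ∑ i ∈ s, ENNReal.ofReal (2 * η / (s.card + 1)) := by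
    calc ENNReal.ofReal (2 * η) = volume (Set.Ioo (-η) η) := by rw [Real.volume_Ioo]; congr 1; ring
      _ ≤ _ := measure_mono hcover
      _ ≤ _ := measure_biUnion_finset_le _ _
      _ ≤ _ := by
        refine Finset.sum_le_sum fun i hi => ?_
        rw [Real.volume_preimage_mul_left (hc i hi), measure_preimage_add]
        refine (mul_le_mul_right (hb i hi) _).trans ?_
        have hci : 0 < |c i| := abs_pos.2 (hc i hi)
        rw [← ENNReal.ofReal_mul (by simp only [hε]; positivity), ← ENNReal.ofReal_mul (abs_nonneg _)]
        apply ENNReal.ofReal_le_ofReal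
        apply le_of_eq
        simp only [hε, abs_inv]
        field_simp
  rw [Finset.sum_const, nsmul_eq_mul, ← ENNReal.ofReal_natCast, ← ENNReal.ofReal_mul (by positivity),
    ENNReal.ofReal_le_ofReal_iff (by positivity), mul_div_assoc', le_div_iff₀ (by positivity)] at hle
  nlinarith

lemma acc_infinite (E D : Set ℝ) (hDE : D ⊆ E) (v0 : ℝ) (η : ℝ) (hη : 0 < η)
    (h : ∃ η0 > (0:ℝ), ∀ η, 0 < η → η < η0 → ∀ v, |v| < η → ∃ y, |y| < η ∧ v0 + v + (1/2) * y ∈ D) :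
    (E ∩ {v | |v - v0| < η}).Infinite := by
  intro hfin
  obtain ⟨η0, hη0, H⟩ := h
  have hcl : IsClosed ((E ∩ {v | |v - v0| < η}) \ {v0}) := (hfin.subset sdiff_subset).isClosed
  obtain ⟨δ, hδ, hb⟩ := Metric.isOpen_iff.1 hcl.isOpen_compl v0 (by simp)
  set τ := min (min η0 η) δ / 2 with hτ
  have hm : 0 < min (min η0 η) δ := by positivity
  have h1 : min (min η0 η) δ ≤ η0 := (min_le_left _ _).trans (min_le_left _ _)
  have h2 : min (min η0 η) δ ≤ η := (min_le_left _ _).trans (min_le_right _ _)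
  have h3 : min (min η0 η) δ ≤ δ := min_le_right _ _
  obtain ⟨y, hy, hyD⟩ := H τ (by positivity) (by linarith) (3/4 * τ)
    (by rw [abs_of_pos (by positivity)]; linarith)
  rw [abs_lt] at hy
  have hin : v0 + 3/4 * τ + 1/2 * y ∈ Metric.ball v0 δ := by
    rw [Metric.mem_ball, Real.dist_eq, abs_lt]; constructor <;> linarith
  refine hb hin ⟨⟨hDE hyD, ?_⟩, ?_⟩
  · rw [mem_ofPred_eq, abs_lt]; constructor <;> linarith
  · rw [mem_singleton_iff]; intro he; linarith

lemma isClosed_nonlinSet (φ : ℝ → ℝ) : IsClosed (NonlinSet φ) := by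
  rw [← isOpen_compl_iff, Metric.isOpen_iff]
  intro t ht
  simp only [NonlinSet, mem_compl_iff, mem_ofPred_eq, not_not] at ht
  obtain ⟨ε, hε, p, q, h⟩ := ht
  refine ⟨ε, hε, fun s hs => ?_⟩
  simp only [NonlinSet, mem_compl_iff, mem_ofPred_eq, not_not]
  rw [Metric.mem_ball, Real.dist_eq] at hs
  refine ⟨ε - |s - t|, by linarith, p, q, fun u hu => h u ?_⟩
  have := abs_add_le (u - s) (s - t)
  rw [sub_add_sub_cancel] at this
  linarith

lemma choose_lines {φ : ℝ → ℝ} (hφ : Continuous φ) (hd : Dense (NonlinSet φ)ᶜ)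
    (D : Set ℝ) (hDE : D ⊆ NonlinSet φ) (hDn : D.Nonempty)
    (hD : ∀ (s : Finset ℕ) (t c : ℕ → ℝ), (∀ i ∈ s, t i ∈ D) → (∀ i ∈ s, c i ≠ 0) →
    ∃ η0 > (0:ℝ), ∀ η, 0 < η → η < η0 → ∀ v, |v| < η →
      ∃ y, |y| < η ∧ ∀ i ∈ s, t i + v + c i * y ∈ D)
    (N : ℕ) (R : Finset ((ℕ → ℝ) × ℝ)) (k : ℕ) : k ≤ N →
    ∃ (p q : ℕ → ℝ) (x0 y0 r : ℝ), 0 < r ∧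
      (∀ i ∈ Finset.Icc 1 k, ∀ x y, |x - x0| < r → |y - y0| < r →
        φ (x + i * y) = p i * (x + i * y) + q i) ∧
      (∀ i ∈ Finset.Ioc k N, x0 + i * y0 ∈ D) ∧
      (∀ l ∈ R, (∃ i ∈ Finset.Icc 1 k, l.1 i ≠ 0) →
        ¬ (∑ i ∈ Finset.Icc 1 k, l.1 i * p i = 0 ∧ ∑ i ∈ Finset.Icc 1 k, l.1 i * q i = l.2)) := by
  classical
  induction k with
  | zero =>
    intro _
    obtain ⟨t0, ht0⟩ := hDn
    exact ⟨0, 0, t0, 0, 1, one_pos, by simp, by simpa using fun _ _ _ => ht0, by simp⟩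
  | succ k ih =>
    intro hk
    obtain ⟨p, q, x0, y0, r, hr, haff, hin, hrel⟩ := ih (by omega)
    set v0 := x0 + (k + 1 : ℕ) * y0 with hv0
    have hv0D : v0 ∈ D := hin (k+1) (by rw [Finset.mem_Ioc]; omega)
    obtain ⟨η0, hη0, HG⟩ := hD (Finset.Ioc (k+1) N) (fun i => x0 + i * y0)
      (fun i => (i:ℝ) - (k + 1 : ℕ))
      (fun i hi => hin i (by rw [Finset.mem_Ioc] at *; omega))
      (fun i hi => sub_ne_zero.2 (by
        have := (Finset.mem_Ioc.1 hi).1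
        exact_mod_cast this.ne'))
    have hk3 : (0:ℝ) < k + 3 := by positivity
    set η := min η0 (r / (k + 3)) / 2 with hη
    have hm : 0 < min η0 (r / (k + 3)) := by positivity
    have hηpos : 0 < η := by positivity
    have hη1 : η < η0 := by have := min_le_left η0 (r / (k + 3)); linarith
    have hη2 : (k + 3) * η ≤ r / 2 := by
      have := min_le_right η0 (r / (k + 3))
      rw [le_div_iff₀ hk3] at this
      nlinarith
    have hinf := acc_infinite (NonlinSet φ) D hDE v0 η hηpos (by
      obtain ⟨e, he, h⟩ := hD {0} (fun _ => v0) (fun _ => 1/2) (fun _ _ => hv0D)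
        (fun _ _ => by norm_num)
      refine ⟨e, he, fun η h1 h2 v hv => ?_⟩
      obtain ⟨y, hy, h⟩ := h η h1 h2 v hv
      exact ⟨y, hy, h 0 (by simp)⟩)
    obtain ⟨v, p', q', ε, hv, hε, hFb, hline⟩ := avoid_lines hφ hd v0 η hinf
      (R.image fun l => (-(∑ i ∈ Finset.Icc 1 k, l.1 i * p i) / l.1 (k+1),
        (l.2 - ∑ i ∈ Finset.Icc 1 k, l.1 i * q i) / l.1 (k+1)))
    obtain ⟨y', hy', hyD⟩ := HG η hηpos hη1 (v - v0) hv
    set y1 := y0 + y' with hy1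
    set x1 := v - (k + 1 : ℕ) * y1 with hx1
    have hk0 : (0:ℝ) ≤ k := Nat.cast_nonneg k
    have hk2 : (0:ℝ) < k + 2 := by positivity
    set r' := min (r / 2) (ε / (k + 2)) with hr'
    have hr'1 : r' ≤ r / 2 := min_le_left _ _
    have hr'2 : (k + 2) * r' ≤ ε := by
      have : r' ≤ ε / (k + 2) := min_le_right _ _
      rw [le_div_iff₀ hk2] at this
      linarith
    have hx10 : |x1 - x0| < r / 2 := by
      have e : x1 - x0 = (v - v0) - (k + 1) * y' := by
        simp only [hx1, hy1, hv0]; push_cast; ring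
      rw [e]
      have h1 := abs_sub (v - v0) ((k + 1) * y')
      rw [abs_mul, abs_of_pos (by positivity : (0:ℝ) < k + 1)] at h1
      nlinarith
    have hy10 : |y1 - y0| < r / 2 := by
      have : y1 - y0 = y' := by simp [hy1]
      rw [this]; nlinarith
    have hupd : ∀ (g : ℕ → ℝ) (a : ℝ), ∀ i ∈ Finset.Icc 1 k, Function.update g (k+1) a i = g i := by
      intro g a i hi
      have := (Finset.mem_Icc.1 hi).2
      exact Function.update_of_ne (by omega) _ _
    have hsum : ∀ (n g : ℕ → ℝ) (a : ℝ), ∑ i ∈ Finset.Icc 1 (k+1),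
        n i * Function.update g (k+1) a i = ∑ i ∈ Finset.Icc 1 k, n i * g i + n (k+1) * a := by
      intro n g a
      rw [Finset.sum_Icc_succ_top (by omega), Function.update_self]
      congr 1
      exact Finset.sum_congr rfl fun i hi => by rw [hupd g a i hi]
    refine ⟨Function.update p (k+1) p', Function.update q (k+1) q', x1, y1, r', by positivity,
      ?_, ?_, ?_⟩
    · intro i hi x y hx hy
      by_cases hik : i = k + 1
      · subst hik
        rw [Function.update_self, Function.update_self]
        apply hline
        have e : x + (k + 1 : ℕ) * y - v = (x - x1) + (k + 1) * (y - y1) := by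
          simp only [hx1]; push_cast; ring
        rw [e]
        have h1 := abs_add_le (x - x1) ((k + 1) * (y - y1))
        rw [abs_mul, abs_of_pos (by positivity : (0:ℝ) < k + 1)] at h1
        nlinarith
      · have hi' : i ∈ Finset.Icc 1 k := by rw [Finset.mem_Icc] at *; omega
        rw [hupd p p' i hi', hupd q q' i hi']
        apply haff i hi'
        · have := abs_add_le (x - x1) (x1 - x0)
          rw [sub_add_sub_cancel] at this
          linarith
        · have := abs_add_le (y - y1) (y1 - y0)
          rw [sub_add_sub_cancel] at this
          linarith
    · intro i hi
      have := hyD i hi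
      convert this using 1
      simp only [hx1, hy1, hv0]
      ring
    · intro l hl hex
      rw [hsum, hsum]
      by_cases hn : l.1 (k+1) = 0
      · rw [hn, zero_mul, zero_mul, add_zero, add_zero]
        apply hrel l hl
        obtain ⟨i, hi, hni⟩ := hex
        refine ⟨i, ?_, hni⟩
        have : i ≠ k + 1 := fun e => hni (e ▸ hn)
        rw [Finset.mem_Icc] at *; omega
      · rintro ⟨h1, h2⟩
        apply hFb
        refine Finset.mem_image.2 ⟨l, hl, Prod.ext ?_ ?_⟩
        · show _ / _ = p'
          rw [div_eq_iff hn]; linarith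
        · show _ / _ = q'
          rw [div_eq_iff hn]; linarith

lemma key_dense {φ : ℝ → ℝ} (hφ : Continuous φ) (hd : Dense (NonlinSet φ)ᶜ)
    (hE : volume (NonlinSet φ) ≠ 0) : KeyProp φ := by
  intro N R hR
  obtain ⟨D, hDE, hnull, hD⟩ := density_set (NonlinSet φ) (isClosed_nonlinSet φ).measurableSet
  have hDn : D.Nonempty := by
    rw [Set.nonempty_iff_ne_empty]
    rintro rfl
    rw [sdiff_empty] at hnull
    exact hE hnull
  obtain ⟨p, q, x0, y0, r, hr, haff, -, hrel⟩ :=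
    choose_lines hφ hd D hDE hDn hD N R N le_rfl
  have o1 : IsOpen {z : ℝ × ℝ | |z.1 - x0| < r} := isOpen_lt (by fun_prop) continuous_const
  have o2 : IsOpen {z : ℝ × ℝ | |z.2 - y0| < r} := isOpen_lt (by fun_prop) continuous_const
  refine generic_avoid hφ N ({z | |z.1 - x0| < r} ∩ {z | |z.2 - y0| < r}) (o1.inter o2)
    ⟨(x0, y0), by simpa using hr, by simpa using hr⟩ R ?_
  intro l hl V hVU hV ⟨z, hz⟩
  by_contra hc
  push Not at hc
  refine hrel l hl (hR l hl).exists_ne ?_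
  have hform : ∀ w ∈ V, (∑ i ∈ Finset.Icc 1 N, l.1 i * p i) * w.1 +
      (∑ i ∈ Finset.Icc 1 N, l.1 i * p i * i) * w.2 + ∑ i ∈ Finset.Icc 1 N, l.1 i * q i = l.2 := by
    intro w hw
    rw [← hc w hw, Finset.sum_mul, Finset.sum_mul, ← Finset.sum_add_distrib, ← Finset.sum_add_distrib]
    refine Finset.sum_congr rfl fun i hi => ?_
    rw [haff i hi _ _ (hVU hw).1 (hVU hw).2]
    ring
  obtain ⟨ε, hε, hb⟩ := Metric.isOpen_iff.1 hV z hz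
  have hmem : ∀ x y, |x - z.1| < ε → |y - z.2| < ε → (x, y) ∈ V := fun x y hx hy =>
    hb (by rw [Metric.mem_ball, Prod.dist_eq]; exact max_lt hx hy)
  have hh : |ε / 2| < ε := by rw [abs_of_pos (by positivity)]; linarith
  have h0 := hform z hz
  have h1 := hform _ (hmem (z.1 + ε / 2) z.2 (by simpa using hh) (by simpa using hε))
  have h2 := hform _ (hmem z.1 (z.2 + ε / 2) (by simpa using hε) (by simpa using hh))
  simp only at h1 h2
  have hε2 : ε / 2 ≠ 0 := by positivity
  have z1 : (∑ i ∈ Finset.Icc 1 N, l.1 i * p i) = 0 := by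
    have : (∑ i ∈ Finset.Icc 1 N, l.1 i * p i) * (ε / 2) = 0 := by linarith
    exact (mul_eq_zero.1 this).resolve_right hε2
  have z2 : (∑ i ∈ Finset.Icc 1 N, l.1 i * p i * i) = 0 := by
    have : (∑ i ∈ Finset.Icc 1 N, l.1 i * p i * i) * (ε / 2) = 0 := by linarith
    exact (mul_eq_zero.1 this).resolve_right hε2
  refine ⟨z1, ?_⟩
  rw [z1, z2] at h0
  linarith

theorem main_theorem (φ : ℝ → ℝ) (hφ : Continuous φ)
    (hE : volume (NonlinSet φ) ≠ 0) :
    ∃ A B : Set ℝ,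
      (∀ N : ℕ, 1 ≤ N → ∃ x y : ℝ, y ≠ 0 ∧
        ∀ k ∈ Finset.Icc 1 N, x + (k : ℝ) * y ∈ A) ∧
      DistinctSumsOfPairs B ∧
      Set.BijOn φ A B := by
  apply main_of_key
  by_cases hI : (interior (NonlinSet φ)).Nonempty
  · exact key_interior hφ hI
  · refine key_dense hφ ?_ hE
    rw [← interior_eq_empty_iff_dense_compl]
    exact Set.not_nonempty_iff_eq_empty.1 hI
end

section
/- Let E1 and E2 be Lebesgue measurable sets in ℝ such that the intersection of the closure of E1° and the closure of E2° has nonzero Lebesgue measure. Then for any positive integer N and any partition of {1, 2, ..., N} into two disjoint sets 𝓔1 and 𝓔2, there exist x ∈ ℝ and y ∈ ℝ with y ≠ 0 such that, setting t_k = x + k·y for k = 1, ..., N, one has t_k ∈ E1° for all k ∈ 𝓔1 and t_k ∈ E2° for all k ∈ 𝓔2. -/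
open MeasureTheory Set Filter

/-- The set of density points of a set `F ⊆ ℝ`. -/
def densityPoints (F : Set ℝ) : Set ℝ :=
  {x | x ∈ F ∧ Filter.Tendsto
    (fun δ : ℝ => volume (F ∩ Set.Ioo (x - δ) (x + δ)) / ENNReal.ofReal (2 * δ))
    (nhdsWithin 0 (Set.Ioi 0)) (nhds 1)}

/-- Lebesgue density theorem for `densityPoints`. -/
lemma null_diff_densityPoints (D : Set ℝ) (hD : MeasurableSet D) :
    volume (D \ densityPoints D) = 0 := by
  have h := Besicovitch.ae_tendsto_measure_inter_div_of_measurableSet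
    (volume : Measure ℝ) hD
  refine measure_mono_null ?_ (ae_iff.1 h)
  rintro x ⟨hx, hnx⟩ hlim
  apply hnx
  refine ⟨hx, ?_⟩
  rw [indicator_of_mem hx] at hlim
  refine hlim.congr' ?_
  filter_upwards [self_mem_nhdsWithin] with δ _
  rw [Real.closedBall_eq_Icc, Real.volume_Icc]
  congr 1
  · exact measure_congr (ae_eq_set_inter (ae_eq_refl D) Ioo_ae_eq_Icc.symm)
  · congr 1; ring

lemma density_bound (D : Set ℝ) (hD : MeasurableSet D) (t : ℝ) (ht : t ∈ densityPoints D)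
    (ε : ℝ) (hε : 0 < ε) :
    ∀ᶠ δ in nhdsWithin (0 : ℝ) (Ioi 0),
      volume (Ioo (t - δ) (t + δ) \ densityPoints D) ≤ ENNReal.ofReal (ε * δ) := by
  have h1 : ENNReal.ofReal (1 - ε / 2) < 1 := by
    rw [ENNReal.ofReal_lt_one]; linarith
  filter_upwards [ht.2.eventually (lt_mem_nhds h1), self_mem_nhdsWithin] with δ hδ hpos
  have hpos : 0 < δ := hpos
  have hne : ENNReal.ofReal (2 * δ) ≠ 0 := by
    simp; exact hpos
  have h2 : ENNReal.ofReal (1 - ε / 2) * ENNReal.ofReal (2 * δ) ≤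
      volume (D ∩ Ioo (t - δ) (t + δ)) :=
    (ENNReal.le_div_iff_mul_le (Or.inl hne) (Or.inl ENNReal.ofReal_ne_top)).1 hδ.le
  have hsub : Ioo (t - δ) (t + δ) \ densityPoints D ⊆
      (Ioo (t - δ) (t + δ) \ D) ∪ (D \ densityPoints D) := by
    rintro z ⟨hz, hz'⟩
    by_cases hzD : z ∈ D
    · exact Or.inr ⟨hzD, hz'⟩
    · exact Or.inl ⟨hz, hzD⟩
  have h3 : volume (Ioo (t - δ) (t + δ) \ densityPoints D) ≤
      volume (Ioo (t - δ) (t + δ) \ D) := by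
    calc _ ≤ _ := measure_mono hsub
      _ ≤ _ := measure_union_le _ _
      _ = _ := by rw [null_diff_densityPoints D hD, add_zero]
  refine h3.trans ?_
  have h4 := measure_inter_add_sdiff (μ := volume) (Ioo (t - δ) (t + δ)) hD
  rw [Real.volume_Ioo, inter_comm] at h4
  have h5 : t + δ - (t - δ) = 2 * δ := by ring
  rw [h5] at h4
  have hf1 : volume (D ∩ Ioo (t - δ) (t + δ)) ≠ ⊤ := by
    intro h; rw [h] at h4; simp only [top_add, add_top] at h4; exact ENNReal.ofReal_ne_top h4.symm
  have hf2 : volume (Ioo (t - δ) (t + δ) \ D) ≠ ⊤ := by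
    intro h; rw [h] at h4; simp only [top_add, add_top] at h4; exact ENNReal.ofReal_ne_top h4.symm
  rw [← ENNReal.ofReal_toReal hf2]
  apply ENNReal.ofReal_le_ofReal
  have h6 := congrArg ENNReal.toReal h4
  rw [ENNReal.toReal_add hf1 hf2, ENNReal.toReal_ofReal (by linarith)] at h6
  have h7 := ENNReal.toReal_mono hf1 h2
  rw [ENNReal.toReal_mul, ENNReal.toReal_ofReal (by linarith : (0 : ℝ) ≤ 2 * δ)] at h7
  have h8 : 1 - ε / 2 ≤ (ENNReal.ofReal (1 - ε / 2)).toReal := by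
    rw [ENNReal.toReal_ofReal']; exact le_max_left _ _
  nlinarith

/-- Replace the `n`-th point of a progression by a point of `A`, keeping the others. -/
lemma step (N n : ℕ) (hn : n ≤ N) (D : ℕ → Set ℝ) (hD : ∀ k, MeasurableSet (D k))
    (A : Set ℝ) (x y : ℝ) (hA : x + n * y ∈ closure A)
    (hx : ∀ k ∈ Finset.Icc 1 N, k ≠ n → x + k * y ∈ densityPoints (D k)) :
    ∃ x' y' : ℝ, y' ≠ 0 ∧ x' + n * y' ∈ A ∧
      ∀ k ∈ Finset.Icc 1 N, k ≠ n → x' + k * y' ∈ densityPoints (D k) := by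
  set R : ℝ := N + 1 with hR
  have hN0 : (0 : ℝ) ≤ N := Nat.cast_nonneg N
  have hRpos : 0 < R := by positivity
  have hev : ∀ᶠ δ in nhdsWithin (0 : ℝ) (Ioi 0), ∀ k ∈ (Finset.Icc 1 N).erase n,
      volume (Ioo (x + k * y - δ) (x + k * y + δ) \ densityPoints (D k))
        ≤ ENNReal.ofReal (1 / R ^ 2 * δ) := by
    rw [Filter.eventually_all_finset]
    intro k hk
    rw [Finset.mem_erase] at hk
    exact density_bound _ (hD k) _ (hx k hk.2 hk.1) _ (by positivity)
  obtain ⟨δ, hδ, hδ0⟩ := (hev.and self_mem_nhdsWithin).exists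
  have hδ0 : 0 < δ := hδ0
  set η : ℝ := δ / R with hη
  have hη0 : 0 < η := by positivity
  have hδη : δ = R * η := by rw [hη]; field_simp
  obtain ⟨s, hsA, hs⟩ := Metric.mem_closure_iff.1 hA η hη0
  rw [dist_comm, Real.dist_eq] at hs
  set bad : ℕ → Set ℝ := fun k =>
    (fun u : ℝ => ((k : ℝ) - n) * u) ⁻¹' ((fun z : ℝ => (s + ((k : ℝ) - n) * y) + z) ⁻¹'
      (Ioo (x + k * y - δ) (x + k * y + δ) \ densityPoints (D k))) with hbad
  have hbadvol : ∀ k ∈ (Finset.Icc 1 N).erase n,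
      volume (bad k) ≤ ENNReal.ofReal (1 / R ^ 2 * δ) := by
    intro k hk
    have hkn : (k : ℤ) - n ≠ 0 := by
      have := (Finset.mem_erase.1 hk).1
      omega
    have hkn1 : (1 : ℝ) ≤ |(k : ℝ) - n| := by
      have := Int.one_le_abs hkn
      exact_mod_cast this
    have hkn0 : (k : ℝ) - n ≠ 0 := by exact_mod_cast hkn
    rw [hbad]
    simp only
    rw [Real.volume_preimage_mul_left hkn0, measure_preimage_add]
    calc _ ≤ 1 * volume (Ioo (x + k * y - δ) (x + k * y + δ) \ densityPoints (D k)) := by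
          gcongr
          rw [ENNReal.ofReal_le_one, abs_inv]
          exact inv_le_one_of_one_le₀ hkn1
      _ ≤ _ := by rw [one_mul]; exact hδ k hk
  have hlt : volume (({-y} : Set ℝ) ∪ ⋃ k ∈ (Finset.Icc 1 N).erase n, bad k) <
      volume (Ioo (-η) η) := by
    calc _ ≤ volume ({-y} : Set ℝ) + volume (⋃ k ∈ (Finset.Icc 1 N).erase n, bad k) :=
          measure_union_le _ _
      _ ≤ 0 + ∑ k ∈ (Finset.Icc 1 N).erase n, volume (bad k) := by
          gcongr
          · simp
          · exact measure_biUnion_finset_le _ _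
      _ ≤ ∑ k ∈ (Finset.Icc 1 N).erase n, ENNReal.ofReal (1 / R ^ 2 * δ) := by
          rw [zero_add]; exact Finset.sum_le_sum hbadvol
      _ ≤ ∑ k ∈ Finset.Icc 1 N, ENNReal.ofReal (1 / R ^ 2 * δ) :=
          Finset.sum_le_sum_of_subset (Finset.erase_subset _ _)
      _ = ENNReal.ofReal (N * (1 / R ^ 2 * δ)) := by
          rw [Finset.sum_const, Nat.card_Icc, nsmul_eq_mul, ENNReal.ofReal_mul hN0]
          simp
      _ < volume (Ioo (-η) η) := by
          rw [Real.volume_Ioo, ENNReal.ofReal_lt_ofReal_iff (by linarith), hδη]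
          have : (N : ℝ) * (1 / R ^ 2 * (R * η)) = (N / R) * η := by field_simp
          rw [this]
          have : (N : ℝ) / R ≤ 1 := by rw [div_le_one hRpos]; linarith
          nlinarith
  obtain ⟨u, hu, hu'⟩ : ∃ u ∈ Ioo (-η) η,
      u ∉ ({-y} : Set ℝ) ∪ ⋃ k ∈ (Finset.Icc 1 N).erase n, bad k := by
    by_contra! hcon
    exact absurd (measure_mono (μ := volume) (show Ioo (-η) η ⊆ _ from hcon)) (not_le.2 hlt)
  refine ⟨s - n * (y + u), y + u, ?_, ?_, ?_⟩
  · intro h0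
    exact hu' (Or.inl (by rw [mem_singleton_iff]; linarith))
  · simpa using hsA
  · intro k hk hkn
    by_contra hnot
    apply hu'
    refine Or.inr ?_
    simp only [mem_iUnion]
    refine ⟨k, Finset.mem_erase.2 ⟨hkn, hk⟩, ?_⟩
    have heq : s + ((k : ℝ) - n) * y + ((k : ℝ) - n) * u = s - n * (y + u) + k * (y + u) := by
      ring
    have hmem : s + ((k : ℝ) - n) * y + ((k : ℝ) - n) * u ∈
        Ioo (x + k * y - δ) (x + k * y + δ) \ densityPoints (D k) := by
      refine ⟨?_, by rw [heq]; exact hnot⟩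
      have habs : |(k : ℝ) - n| ≤ N := by
        have h1 : (k : ℝ) ≤ N := by exact_mod_cast (Finset.mem_Icc.1 hk).2
        have h2 : (n : ℝ) ≤ N := by exact_mod_cast hn
        have h3 : (0 : ℝ) ≤ k := Nat.cast_nonneg k
        have h4 : (0 : ℝ) ≤ n := Nat.cast_nonneg n
        rw [abs_le]; constructor <;> linarith
      have hmul : |((k : ℝ) - n) * u| ≤ N * η := by
        rw [abs_mul]
        have : |u| ≤ η := (abs_lt.2 hu).le
        gcongr
      have h1 := abs_lt.1 hs
      have h2 := abs_le.1 hmul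
      have h3 : δ = N * η + η := by rw [hδη, hR]; ring
      constructor <;> nlinarith
    exact hmem

theorem combinatorial_lemma (E₁ E₂ : Set ℝ)
    (hE₁ : MeasurableSet E₁) (hE₂ : MeasurableSet E₂)
    (hmass : volume (closure (densityPoints E₁) ∩ closure (densityPoints E₂)) ≠ 0)
    (N : ℕ) (hN : 0 < N) (𝓔₁ 𝓔₂ : Finset ℕ)
    (hdisj : Disjoint 𝓔₁ 𝓔₂) (hunion : 𝓔₁ ∪ 𝓔₂ = Finset.Icc 1 N) :
    ∃ x y : ℝ, y ≠ 0 ∧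
      (∀ k ∈ 𝓔₁, x + (k : ℝ) * y ∈ densityPoints E₁) ∧
      (∀ k ∈ 𝓔₂, x + (k : ℝ) * y ∈ densityPoints E₂) := by
  classical
  set C := closure (densityPoints E₁) ∩ closure (densityPoints E₂) with hC
  have hCm : MeasurableSet C := (isClosed_closure.inter isClosed_closure).measurableSet
  obtain ⟨c, hc⟩ : (densityPoints C).Nonempty := by
    by_contra hne
    rw [not_nonempty_iff_eq_empty] at hne
    have := null_diff_densityPoints C hCm
    rw [hne, sdiff_empty] at this
    exact hmass this
  set E : ℕ → Set ℝ := fun k => if k ∈ 𝓔₁ then E₁ else E₂ with hE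
  have hEm : ∀ k, MeasurableSet (E k) := by
    intro k; simp only [hE]; split_ifs <;> assumption
  have hCE : ∀ k, C ⊆ closure (densityPoints (E k)) := by
    intro k; simp only [hE]; split_ifs
    · exact inter_subset_left
    · exact inter_subset_right
  have key : ∀ T : Finset ℕ, T ⊆ Finset.Icc 1 N → ∃ x y : ℝ, (T.Nonempty → y ≠ 0) ∧
      ∀ k ∈ Finset.Icc 1 N, x + k * y ∈ densityPoints (if k ∈ T then E k else C) := by
    intro T
    induction T using Finset.induction_on with
    | empty => intro _; exact ⟨c, 0, by simp, by simpa using fun _ _ _ => hc⟩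
    | insert n T hnT ih =>
      intro hsub
      obtain ⟨x, y, -, hxy⟩ := ih ((Finset.subset_insert _ _).trans hsub)
      have hn := hsub (Finset.mem_insert_self n T)
      have hnC : x + n * y ∈ C := by
        have := hxy n hn
        rw [if_neg hnT] at this
        exact this.1
      obtain ⟨x', y', hy', hA, hrest⟩ := step N n (Finset.mem_Icc.1 hn).2
        (fun k => if k ∈ T then E k else C)
        (fun k => by split_ifs; exacts [hEm k, hCm])
        (densityPoints (E n)) x y (hCE n hnC) (fun k hk _ => hxy k hk)
      refine ⟨x', y', fun _ => hy', fun k hk => ?_⟩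
      by_cases hkn : k = n
      · subst hkn; simpa using hA
      · simpa [Finset.mem_insert, hkn] using hrest k hk hkn
  obtain ⟨x, y, hy, hxy⟩ := key _ (Finset.Subset.refl _)
  refine ⟨x, y, hy ⟨1, Finset.mem_Icc.2 ⟨le_refl _, hN⟩⟩, fun k hk => ?_, fun k hk => ?_⟩
  · have hk' : k ∈ Finset.Icc 1 N := hunion ▸ Finset.mem_union_left _ hk
    have := hxy k hk'
    rw [if_pos hk'] at this
    simpa only [hE, if_pos hk] using this
  · have hk' : k ∈ Finset.Icc 1 N := hunion ▸ Finset.mem_union_right _ hk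
    have := hxy k hk'
    rw [if_pos hk'] at this
    have hk1 : k ∉ 𝓔₁ := fun h => Finset.disjoint_left.1 hdisj h hk
    simpa only [hE, if_neg hk1] using this
end

section
/- Let a < b be real numbers and let φ : [a, b] → ℝ be continuous. Suppose the set of points t ∈ (a, b) having no open neighborhood on which φ coincides with an affine function has nonzero Lebesgue measure. Then there exist a set A ⊆ [a, b] containing arithmetic progressions of every length and a set B ⊆ ℝ with distinct sums of pairs such that φ maps A bijectively onto B. -/
open MeasureTheory Set

def Dens (K : Set ℝ) : Prop :=
  ∀ t ∈ K, ∀ η > (0:ℝ), ∃ r0 > (0:ℝ), ∀ r, 0 < r → r < r0 →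
    volume (Metric.ball t r \ K) ≤ ENNReal.ofReal (η * r)

lemma dens_exists {K : Set ℝ} (hK : Dens K) {ι : Type} [Fintype ι] (t κ : ι → ℝ)
    (ht : ∀ i, t i ∈ K) (hκ : ∀ i, κ i ≠ 0) {ε : ℝ} (hε : 0 < ε) :
    ∃ ρ > (0:ℝ), ∀ σ : ι → ℝ, (∀ i, |σ i| < ρ) →
      ∃ u, |u| < ε ∧ ∀ i, t i + κ i * u + σ i ∈ K := by
  classical
  set n : ℝ := (Fintype.card ι : ℝ) with hn
  have hn0 : 0 ≤ n := by positivity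
  have hη : 0 < 1 / (n + 1) := by positivity
  choose r0 hr0 hr using fun i => hK (t i) (ht i) _ hη
  have key : ∀ c : ι → ℝ, (∀ i, 0 < c i) → ∃ r > (0:ℝ), ∀ i, r < c i := by
    intro c hc
    have h1 : ∀ᶠ r in nhdsWithin (0:ℝ) (Ioi 0), ∀ i, r < c i := by
      rw [Filter.eventually_all]
      intro i
      exact (eventually_lt_nhds (hc i)).filter_mono nhdsWithin_le_nhds
    have h2 : ∀ᶠ r in nhdsWithin (0:ℝ) (Ioi 0), 0 < r := eventually_mem_nhdsWithin
    obtain ⟨r, h, h'⟩ := (h1.and h2).exists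
    exact ⟨r, h', h⟩
  have hκ' : ∀ i, 0 < |κ i| := fun i => abs_pos.2 (hκ i)
  obtain ⟨r1, hr1, hr1'⟩ := key (fun i => r0 i / (2 * |κ i|))
    (fun i => by have := hκ' i; have := hr0 i; positivity)
  set r := min r1 ε with hrdef
  have hrpos : 0 < r := lt_min hr1 hε
  obtain ⟨ρ, hρ, hρ'⟩ := key (fun i => |κ i| * r) (fun i => mul_pos (hκ' i) hrpos)
  refine ⟨ρ, hρ, fun σ hσ => ?_⟩
  by_contra! hcon
  have hcov : Metric.ball (0:ℝ) r ⊆ ⋃ i, {u | u ∈ Metric.ball (0:ℝ) r ∧ t i + κ i * u + σ i ∉ K} := by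
    intro u hu
    have hu' : |u| < r := by simpa using hu
    obtain ⟨i, hi⟩ := hcon u (hu'.trans_le (min_le_right _ _))
    exact mem_iUnion.2 ⟨i, hu, hi⟩
  have hbad : ∀ i, volume {u | u ∈ Metric.ball (0:ℝ) r ∧ t i + κ i * u + σ i ∉ K}
      ≤ ENNReal.ofReal (1 / (n+1) * (2 * r)) := by
    intro i
    have hk := hκ' i
    have hsub : {u | u ∈ Metric.ball (0:ℝ) r ∧ t i + κ i * u + σ i ∉ K} ⊆
        (fun u => κ i * u) ⁻¹' ((fun v => v + (t i + σ i)) ⁻¹' (Metric.ball (t i) (2 * |κ i| * r) \ K)) := by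
      rintro u ⟨hu, hu2⟩
      have hu' : |u| < r := by simpa using hu
      refine ⟨?_, ?_⟩
      · simp only [Metric.mem_ball, Real.dist_eq]
        have : κ i * u + (t i + σ i) - t i = κ i * u + σ i := by ring
        rw [this]
        calc |κ i * u + σ i| ≤ |κ i| * |u| + |σ i| := by
              rw [← abs_mul]; exact abs_add_le _ _
          _ < |κ i| * r + |κ i| * r :=
              add_lt_add (mul_lt_mul_of_pos_left hu' hk) ((hσ i).trans (hρ' i))
          _ = _ := by ring
      · have : κ i * u + (t i + σ i) = t i + κ i * u + σ i := by ring
        simpa [this] using hu2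
    have hlt : 2 * |κ i| * r < r0 i := by
      have h1 : r < r0 i / (2 * |κ i|) := (min_le_left _ _).trans_lt (hr1' i)
      rw [lt_div_iff₀ (by positivity)] at h1
      linarith
    calc _ ≤ _ := measure_mono hsub
      _ = ENNReal.ofReal |(κ i)⁻¹| * volume (Metric.ball (t i) (2 * |κ i| * r) \ K) := by
          rw [Real.volume_preimage_mul_left (hκ i), measure_preimage_add_right]
      _ ≤ ENNReal.ofReal |(κ i)⁻¹| * ENNReal.ofReal (1/(n+1) * (2 * |κ i| * r)) := by
          gcongr
          exact hr i _ (by positivity) hlt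
      _ = _ := by
          rw [← ENNReal.ofReal_mul (abs_nonneg _), abs_inv]
          congr 1
          field_simp
  have h1 : volume (Metric.ball (0:ℝ) r) ≤ ENNReal.ofReal (n * (1 / (n+1) * (2 * r))) := by
    calc _ ≤ _ := measure_mono hcov
      _ ≤ ∑ i, _ := measure_iUnion_fintype_le _ _
      _ ≤ ∑ i : ι, ENNReal.ofReal (1 / (n+1) * (2 * r)) := Finset.sum_le_sum fun i _ => hbad i
      _ = _ := by
          rw [Finset.sum_const, Finset.card_univ, nsmul_eq_mul, ENNReal.ofReal_mul hn0, hn]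
          simp
  rw [Real.volume_ball, ENNReal.ofReal_le_ofReal_iff (by positivity)] at h1
  have : n * (1 / (n+1) * (2 * r)) < 2 * r := by
    rw [show n * (1 / (n+1) * (2 * r)) = (n * (2*r)) / (n+1) by field_simp, div_lt_iff₀ (by positivity)]
    nlinarith
  linarith

lemma lin_add (D : ℝ → ℝ) {r M : ℝ} (hr : 0 < r) (hb : ∀ h, |h| < r → |D h| ≤ M)
    (hadd : ∀ h k, |h| < r → |k| < r → |h + k| < r → D (h + k) = D h + D k) :
    ∃ m, ∀ h, |h| < r → D h = m * h := by
  have hM : 0 ≤ M := (abs_nonneg _).trans (hb 0 (by simpa))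
  set m := D (r/2) / (r/2) with hm
  set E : ℝ → ℝ := fun h => D h - m * h with hE
  have Eb : ∀ h, |h| < r → |E h| ≤ M + |m| * r := by
    intro h hh
    calc |D h - m * h| ≤ |D h| + |m * h| := abs_sub _ _
      _ ≤ M + |m| * r := by rw [abs_mul]; gcongr; exact hb h hh
  have Ea : ∀ h k, |h| < r → |k| < r → |h + k| < r → E (h + k) = E h + E k := by
    intro h k h1 h2 h3
    simp only [hE]; rw [hadd h k h1 h2 h3]; ring
  have E0 : E (r/2) = 0 := by simp only [hE, hm]; field_simp; ring
  have Ez : E 0 = 0 := by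
    have := Ea 0 0 (by simpa) (by simpa) (by simpa)
    simp at this; exact this
  have En : ∀ n : ℕ, ∀ h, 0 ≤ h → n * h < r → E (n * h) = n * E h := by
    intro n
    induction n with
    | zero => intro h _ _; simp [Ez]
    | succ n ih =>
      intro h h0 h1
      push_cast at h1 ⊢
      have h2 : 0 ≤ (n:ℝ) * h := by positivity
      have h3 : (n:ℝ) * h < r := by nlinarith
      have h4 : h < r := by nlinarith
      rw [show ((n:ℝ) + 1) * h = n * h + h by ring, Ea, ih h h0 h3]
      · ring
      · rwa [abs_of_nonneg h2]
      · rwa [abs_of_nonneg h0]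
      · rw [abs_of_nonneg (by positivity)]; linarith
  have pos : ∀ h, 0 ≤ h → h < r → E h = 0 := by
    intro h h0 h1
    have hall : ∀ n : ℕ, (n:ℝ) * |E h| ≤ M + |m| * r := by
      intro n
      rcases Nat.eq_zero_or_pos n with rfl | hn
      · simp; positivity
      have hn' : (0:ℝ) < n := by exact_mod_cast hn
      set w := r / 2 / n with hw
      have hwp : 0 < w := by positivity
      have hnw : n * w = r / 2 := by rw [hw]; field_simp
      have Ew : E w = 0 := by
        have := En n w hwp.le (by rw [hnw]; linarith)
        rw [hnw, E0] at this
        rcases mul_eq_zero.1 this.symm with h | h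
        · exact absurd h hn'.ne'
        · exact h
      set j := ⌊h / w⌋₊ with hj
      have hj1 : (j:ℝ) * w ≤ h := by
        have := Nat.floor_le (show 0 ≤ h / w by positivity)
        rwa [le_div_iff₀ hwp] at this
      have hj2 : h < ((j:ℝ) + 1) * w := by
        have := Nat.lt_floor_add_one (h / w)
        rwa [div_lt_iff₀ hwp] at this
      set ρ := h - j * w with hρ
      have hρ0 : 0 ≤ ρ := by linarith
      have hρ1 : ρ < w := by linarith
      have hjw0 : 0 ≤ (j:ℝ) * w := by positivity
      have e1 : E h = E ρ := by
        have := Ea (j * w) ρ (by rw [abs_of_nonneg hjw0]; linarith)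
          (by rw [abs_of_nonneg hρ0]; linarith) (by rw [abs_of_nonneg (by linarith)]; linarith)
        rw [En j w hwp.le (by linarith), Ew] at this
        rw [show h = j * w + ρ by rw [hρ]; ring, this]; ring
      have hnρ : n * ρ < r := by nlinarith
      have e2 := En n ρ hρ0 hnρ
      have e3 : (n:ℝ) * |E ρ| = |n * E ρ| := by rw [abs_mul, abs_of_pos hn']
      rw [e1, e3, ← e2]
      exact Eb _ (by rwa [abs_of_nonneg (by positivity)])
    by_contra hne
    have hp : 0 < |E h| := abs_pos.2 hne
    obtain ⟨n, hn⟩ := exists_nat_gt ((M + |m| * r) / |E h|)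
    rw [div_lt_iff₀ hp] at hn
    linarith [hall n]
  refine ⟨m, fun h hh => ?_⟩
  have : E h = 0 := by
    rcases le_total 0 h with h0 | h0
    · exact pos h h0 ((le_abs_self h).trans_lt hh)
    · have h1 := pos (-h) (by linarith) ((neg_le_abs h).trans_lt hh)
      have h2 := Ea h (-h) hh (by rwa [abs_neg]) (by simpa)
      simp only [add_neg_cancel, Ez, h1] at h2
      linarith
  simp only [hE] at this; linarith

lemma pick {K : Set ℝ} (hK : Dens K) {s0 : ℝ} (h0 : s0 ∈ K) (n : ℕ) {ε : ℝ} (hε : 0 < ε) :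
    ∃ ρ > (0:ℝ), ∀ σ : Fin n → ℝ, (∀ i, |σ i| < ρ) → ∃ s, |s - s0| < ε ∧ ∀ i, s + σ i ∈ K := by
  obtain ⟨ρ, hρ, h⟩ := dens_exists hK (fun _ : Fin n => s0) (fun _ => 1) (fun _ => h0)
    (fun _ => one_ne_zero) hε
  refine ⟨ρ, hρ, fun σ hσ => ?_⟩
  obtain ⟨u, hu, hu'⟩ := h σ hσ
  exact ⟨s0 + u, by simpa using hu, fun i => by simpa using hu' i⟩

lemma quad_on {K : Set ℝ} (hK : Dens K) {s0 : ℝ} (h0 : s0 ∈ K) (f : ℝ → ℝ) {M ρ0 : ℝ}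
    (hρ0 : 0 < ρ0) (hM : ∀ s, |s - s0| < ρ0 → |f s| ≤ M)
    (cube : ∀ s h1 h2 h3, |s - s0| < ρ0 → |h1| < ρ0 → |h2| < ρ0 → |h3| < ρ0 →
      s ∈ K → s + h1 ∈ K → s + h2 ∈ K → s + h3 ∈ K → s + h1 + h2 ∈ K → s + h1 + h3 ∈ K →
      s + h2 + h3 ∈ K → s + h1 + h2 + h3 ∈ K →
      f s = f (s + h1) + f (s + h2) + f (s + h3) - f (s + h1 + h2) - f (s + h1 + h3)
        - f (s + h2 + h3) + f (s + h1 + h2 + h3)) :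
    ∃ ρ > (0:ℝ), ∃ q p c : ℝ, ∀ s ∈ K, |s - s0| < ρ → f s = q * s ^ 2 + p * s + c := by
  obtain ⟨ρ1, hρ1, pk⟩ := pick hK h0 6 (show 0 < ρ0 / 4 by positivity)
  obtain ⟨r, hr, hr1, hr2⟩ : ∃ r > (0:ℝ), 3 * r < ρ1 ∧ 8 * r < ρ0 :=
    ⟨min ρ1 ρ0 / 9, by positivity, by have := min_le_left ρ1 ρ0; linarith,
      by have := min_le_right ρ1 ρ0; linarith⟩
  have exS : ∀ h k, ∃ s, |h| < r → |k| < r →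
      |s - s0| < ρ0 / 4 ∧ s ∈ K ∧ s + h ∈ K ∧ s + k ∈ K ∧ s + h + k ∈ K := by
    intro h k
    by_cases hh : |h| < r ∧ |k| < r
    · obtain ⟨hh1, hh2⟩ := hh
      obtain ⟨s, hs, hs'⟩ := pk ![0, h, k, h + k, 0, 0] (by
        rw [abs_lt] at hh1 hh2
        intro i; fin_cases i <;> simp [abs_lt] <;> (try constructor) <;> linarith)
      refine ⟨s, fun _ _ => ⟨hs, ?_, ?_, ?_, ?_⟩⟩
      · simpa using hs' 0
      · simpa using hs' 1
      · simpa using hs' 2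
      · simpa [add_assoc] using hs' 3
    · exact ⟨0, fun a b => absurd ⟨a, b⟩ hh⟩
  choose S hS using exS
  set B : ℝ → ℝ → ℝ := fun h k => f (S h k + h + k) - f (S h k + h) - f (S h k + k) + f (S h k) with hB
  have Bind : ∀ h k s, |h| < r → |k| < r → |s - s0| < ρ0 / 2 → s ∈ K → s + h ∈ K → s + k ∈ K →
      s + h + k ∈ K → f (s + h + k) - f (s + h) - f (s + k) + f s = B h k := by
    intro h k s hh hk hs a1 a2 a3 a4
    obtain ⟨b0, b1, b2, b3, b4⟩ := hS h k hh hk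
    have e1 : s + (S h k - s) = S h k := by ring
    have e2 : s + h + (S h k - s) = S h k + h := by ring
    have e3 : s + k + (S h k - s) = S h k + k := by ring
    have e4 : s + h + k + (S h k - s) = S h k + h + k := by ring
    have := cube s h k (S h k - s) (by linarith) (by linarith) (by linarith)
      (by rw [abs_lt] at *; constructor <;> linarith) a1 a2 a3 (by rwa [e1]) a4 (by rwa [e2])
      (by rwa [e3]) (by rwa [e4])
    rw [e1, e2, e3, e4] at this
    simp only [hB]; linarith
  have Bsymm : ∀ h k, |h| < r → |k| < r → B h k = B k h := by
    intro h k hh hk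
    obtain ⟨b0, b1, b2, b3, b4⟩ := hS h k hh hk
    have := Bind k h (S h k) hk hh (by linarith) b1 b3 b2 (by rwa [add_right_comm])
    rw [← this, add_right_comm]; simp only [hB]; ring
  have Badd : ∀ k, |k| < r → ∀ h h', |h| < r → |h'| < r → |h + h'| < r →
      B (h + h') k = B h k + B h' k := by
    intro k hk h h' hh hh' hhh
    obtain ⟨s, hs, hs'⟩ := pk ![0, h, h + h', k, h + k, h + h' + k] (by
        rw [abs_lt] at *
        intro i; fin_cases i <;> simp [abs_lt] <;> (try constructor) <;> linarith)
    have a0 := hs' 0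
    have a1 := hs' 1
    have a2 := hs' 2
    have a3 := hs' 3
    have a4 := hs' 4
    have a5 := hs' 5
    simp [← add_assoc] at a0 a1 a2 a3 a4 a5
    rw [← Bind (h + h') k s hhh hk (by linarith) a0 (by rwa [← add_assoc]) a3 (by rwa [← add_assoc]),
      ← Bind h k s hh hk (by linarith) a0 a1 a3 a4,
      ← Bind h' k (s + h) hh' hk (by rw [abs_lt] at *; constructor <;> linarith) a1 a2 a4 a5]
    rw [← add_assoc]; ring
  have hfb : ∀ s h, |s - s0| < ρ0 / 2 → |h| < ρ0 / 2 → |f (s + h)| ≤ M := by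
    intro s h h1 h2
    apply hM; rw [abs_lt] at *; constructor <;> linarith
  have Bbd : ∀ k, |k| < r → ∀ h, |h| < r → |B h k| ≤ 4 * M := by
    intro k hk h hh
    obtain ⟨b0, -⟩ := hS h k hh hk
    have c1 := hfb (S h k) (h + k) (by linarith) (by rw [abs_lt] at *; constructor <;> linarith)
    have c2 := hfb (S h k) h (by linarith) (by linarith)
    have c3 := hfb (S h k) k (by linarith) (by linarith)
    have c4 := hM (S h k) (by linarith)
    rw [← add_assoc] at c1
    simp only [hB]
    rw [abs_le] at *
    constructor <;> linarith
  have exm : ∀ k, ∃ m, |k| < r → ∀ h, |h| < r → B h k = m * h := by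
    intro k
    by_cases hk : |k| < r
    · obtain ⟨m, hm⟩ := lin_add (fun h => B h k) hr (Bbd k hk) (Badd k hk)
      exact ⟨m, fun _ => hm⟩
    · exact ⟨0, fun h => absurd h hk⟩
  choose m hm using exm
  have hr2' : |r / 2| < r := by rw [abs_of_pos (by positivity)]; linarith
  set q := m (r/2) / r with hq
  have Bq : ∀ h k, |h| < r → |k| < r → B h k = 2 * q * h * k := by
    intro h k hh hk
    have e1 := hm k hk (r/2) hr2'
    have e2 := hm (r/2) hr2' k hk
    rw [Bsymm k (r/2) hk hr2', e1] at e2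
    have : m k = 2 * q * k := by
      rw [hq]; field_simp; linarith
    rw [hm k hk h hh, this]; ring
  set g : ℝ → ℝ := fun s => f s - q * s ^ 2 with hg
  have gsq : ∀ h k s, |h| < r → |k| < r → |s - s0| < ρ0 / 2 → s ∈ K → s + h ∈ K → s + k ∈ K →
      s + h + k ∈ K → g (s + h + k) - g (s + h) - g (s + k) + g s = 0 := by
    intro h k s hh hk hs a1 a2 a3 a4
    have := Bind h k s hh hk hs a1 a2 a3 a4
    rw [Bq h k hh hk] at this
    simp only [hg]; linear_combination this
  obtain ⟨ρ2, hρ2, pk2⟩ := pick hK h0 3 (show 0 < r / 4 by positivity)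
  obtain ⟨w, hw, hw1, hw2⟩ : ∃ w > (0:ℝ), 3 * w < ρ2 ∧ 8 * w < r :=
    ⟨min ρ2 r / 9, by positivity, by have := min_le_left ρ2 r; linarith,
      by have := min_le_right ρ2 r; linarith⟩
  have exT : ∀ h, ∃ s, |h| < w → |s - s0| < r / 4 ∧ s ∈ K ∧ s + h ∈ K := by
    intro h
    by_cases hh1 : |h| < w
    · obtain ⟨s, hs, hs'⟩ := pk2 ![0, h, 0] (by
        rw [abs_lt] at hh1
        intro i; fin_cases i <;> simp [abs_lt] <;> (try constructor) <;> linarith)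
      refine ⟨s, fun _ => ⟨hs, ?_, ?_⟩⟩
      · simpa using hs' 0
      · simpa using hs' 1
    · exact ⟨0, fun a => absurd a hh1⟩
  choose T hT using exT
  set D : ℝ → ℝ := fun h => g (T h + h) - g (T h) with hD
  have Dind : ∀ h s, |h| < w → |s - s0| < r / 2 → s ∈ K → s + h ∈ K → g (s + h) - g s = D h := by
    intro h s hh hs a1 a2
    obtain ⟨b0, b1, b2⟩ := hT h hh
    have e1 : s + (T h - s) = T h := by ring
    have e2 : s + h + (T h - s) = T h + h := by ring
    have := gsq h (T h - s) s (by linarith) (by rw [abs_lt] at *; constructor <;> linarith)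
      (by linarith) a1 a2 (by rwa [e1]) (by rwa [e2])
    rw [e1, e2] at this
    simp only [hD]; linarith
  have Dadd : ∀ h h', |h| < w → |h'| < w → |h + h'| < w → D (h + h') = D h + D h' := by
    intro h h' hh hh' hhh
    obtain ⟨s, hs, hs'⟩ := pk2 ![0, h, h + h'] (by
        rw [abs_lt] at *
        intro i; fin_cases i <;> simp [abs_lt] <;> (try constructor) <;> linarith)
    have a0 := hs' 0
    have a1 := hs' 1
    have a2 := hs' 2
    simp [← add_assoc] at a0 a1 a2
    obtain ⟨b0, b1, b2⟩ := hT h' hh'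
    have e1 : s + h + (T h' - (s + h)) = T h' := by ring
    have e2 : s + h + h' + (T h' - (s + h)) = T h' + h' := by ring
    have h3 := gsq h' (T h' - (s + h)) (s + h) (by linarith)
      (by rw [abs_lt] at *; constructor <;> linarith)
      (by rw [abs_lt] at *; constructor <;> linarith) a1 a2 (by rwa [e1]) (by rwa [e2])
    rw [e1, e2] at h3
    have h1 := Dind (h + h') s hhh (by linarith) a0 (by rwa [← add_assoc])
    have h2 := Dind h s hh (by linarith) a0 a1
    rw [← add_assoc] at h1
    rw [← h1, ← h2]
    simp only [hD]; linarith
  have Dbd : ∀ h, |h| < w → |D h| ≤ 2 * M + |q| * ((|s0| + r) ^ 2 + (|s0| + r) ^ 2) := by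
    intro h hh
    obtain ⟨b0, -⟩ := hT h hh
    have c2 := hfb (T h) h (by linarith) (by linarith)
    have c4 := hM (T h) (by linarith)
    have d1 : (T h + h) ^ 2 ≤ (|s0| + r) ^ 2 := by
      apply sq_le_sq'
      · have := neg_abs_le s0; rw [abs_lt] at *; linarith
      · have := le_abs_self s0; rw [abs_lt] at *; linarith
    have d2 : (T h) ^ 2 ≤ (|s0| + r) ^ 2 := by
      apply sq_le_sq'
      · have := neg_abs_le s0; rw [abs_lt] at *; linarith
      · have := le_abs_self s0; rw [abs_lt] at *; linarith
    have e1 : |q * (T h + h) ^ 2| ≤ |q| * (|s0| + r) ^ 2 := by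
      rw [abs_mul, abs_of_nonneg (sq_nonneg (T h + h))]; gcongr
    have e2 : |q * (T h) ^ 2| ≤ |q| * (|s0| + r) ^ 2 := by
      rw [abs_mul, abs_of_nonneg (sq_nonneg (T h))]; gcongr
    simp only [hD, hg]
    rw [abs_le] at *
    constructor <;> linarith
  obtain ⟨p, hp⟩ := lin_add D hw Dbd Dadd
  refine ⟨w, hw, q, p, g s0 - p * s0, fun s hs hs' => ?_⟩
  have := Dind (s - s0) s0 hs' (by simpa using by positivity) h0 (by simpa using hs)
  rw [hp _ hs'] at this
  simp only [hg, add_sub_cancel] at this ⊢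
  linarith

lemma dichotomy {J : Type} [Fintype J] (R : J → ℝ × ℝ → ℝ) (hR : ∀ j, Continuous (R j))
    (Z O : Set (ℝ × ℝ)) (hO : IsOpen O) (p : ℝ × ℝ) (hp : p ∈ O) (hpZ : p ∈ Z) :
    ∃ p' O', IsOpen O' ∧ O' ⊆ O ∧ p' ∈ O' ∧ p' ∈ Z ∧
      ∀ j, (∀ x ∈ O', R j x ≠ 0) ∨ (∀ x ∈ O', x ∈ Z → R j x = 0) := by
  classical
  suffices H : ∀ T : Finset J, ∃ p' O', IsOpen O' ∧ O' ⊆ O ∧ p' ∈ O' ∧ p' ∈ Z ∧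
      ∀ j ∈ T, (∀ x ∈ O', R j x ≠ 0) ∨ (∀ x ∈ O', x ∈ Z → R j x = 0) by
    simpa using H Finset.univ
  intro T
  induction T using Finset.induction_on with
  | empty => exact ⟨p, O, hO, subset_rfl, hp, hpZ, by simp⟩
  | insert j T _ ih =>
    obtain ⟨p', O', h1, h2, h3, h4, h5⟩ := ih
    by_cases h : ∀ x ∈ O', x ∈ Z → R j x = 0
    · refine ⟨p', O', h1, h2, h3, h4, fun i hi => ?_⟩
      rcases Finset.mem_insert.1 hi with rfl | hi
      · exact Or.inr h
      · exact h5 i hi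
    · push Not at h
      obtain ⟨x, hx, hxZ, hne⟩ := h
      refine ⟨x, O' ∩ {y | R j y ≠ 0}, h1.inter (isOpen_ne_fun (hR j) continuous_const),
        inter_subset_left.trans h2, ⟨hx, hne⟩, hxZ, fun i hi => ?_⟩
      rcases Finset.mem_insert.1 hi with rfl | hi
      · exact Or.inl fun y hy => hy.2
      · rcases h5 i hi with h | h
        · exact Or.inl fun y hy => h y hy.1
        · exact Or.inr fun y hy => h y hy.1

lemma alt_rhs (φ : ℝ → ℝ) (a1 a2 a3 c1 c2 c3 d : ℝ) (h1 : a1 ≠ 0) (h2 : a2 ≠ 0) (h3 : a3 ≠ 0)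
    (G : ℝ → ℝ → ℝ)
    (hG : ∀ s y, G s y = d + c1 * φ (s + a1 * y) + c2 * φ (s + a2 * y) + c3 * φ (s + a3 * y))
    (s y u1 u2 u3 : ℝ) :
    G s y = G (s + u1) (y - u1 / a1) + G (s + u2) (y - u2 / a2) + G (s + u3) (y - u3 / a3)
      - G (s + u1 + u2) (y - u1 / a1 - u2 / a2) - G (s + u1 + u3) (y - u1 / a1 - u3 / a3)
      - G (s + u2 + u3) (y - u2 / a2 - u3 / a3)
      + G (s + u1 + u2 + u3) (y - u1 / a1 - u2 / a2 - u3 / a3) := by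
  simp only [hG]
  have e1 : ∀ z w, z + u1 + a1 * (w - u1 / a1) = z + a1 * w := by intros; field_simp; ring
  have e2 : ∀ z w, z + u2 + a2 * (w - u2 / a2) = z + a2 * w := by intros; field_simp; ring
  have e3 : ∀ z w, z + u3 + a3 * (w - u3 / a3) = z + a3 * w := by intros; field_simp; ring
  have f1 : s + u1 + u2 + a1 * (y - u1 / a1 - u2 / a2) = s + u2 + a1 * (y - u2 / a2) := by
    field_simp; ring
  have f2 : s + u1 + u3 + a1 * (y - u1 / a1 - u3 / a3) = s + u3 + a1 * (y - u3 / a3) := by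
    field_simp; ring
  have f3 : s + u1 + u2 + u3 + a1 * (y - u1 / a1 - u2 / a2 - u3 / a3)
      = s + u2 + u3 + a1 * (y - u2 / a2 - u3 / a3) := by
    field_simp; ring
  have f4 : s + u2 + u3 + a2 * (y - u2 / a2 - u3 / a3) = s + u3 + a2 * (y - u3 / a3) := by
    field_simp; ring
  have f5 : s + u1 + u2 + u3 + a2 * (y - u1 / a1 - u2 / a2 - u3 / a3)
      = s + u1 + u3 + a2 * (y - u1 / a1 - u3 / a3) := by
    field_simp; ring
  rw [f1, f2, f3, f4, f5]
  simp only [e1, e2, e3]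
  ring

lemma cube_lemma {K : Set ℝ} (hK : Dens K) {ι J : Type} [Fintype ι] [Fintype J] [Nonempty J] (κ : ι → ℝ)
    (hκ : ∀ i, κ i ≠ 0) (i1 i2 i3 : J → ι) {s0 y0 : ℝ} (h0 : ∀ i, s0 + κ i * y0 ∈ K)
    {ε : ℝ} (hε : 0 < ε) :
    ∃ ρ > (0:ℝ), ∀ s u1 u2 u3, |s - s0| < ρ → |u1| < ρ → |u2| < ρ → |u3| < ρ →
      ∃ y, |y - y0| < ε ∧ (∀ i, s + κ i * y ∈ K) ∧ ∀ j, ∀ e1 e2 e3 : Fin 2,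
        |y - e1 * (u1 / κ (i1 j)) - e2 * (u2 / κ (i2 j)) - e3 * (u3 / κ (i3 j)) - y0| < ε ∧
        ∀ i, s + e1 * u1 + e2 * u2 + e3 * u3 +
          κ i * (y - e1 * (u1 / κ (i1 j)) - e2 * (u2 / κ (i2 j)) - e3 * (u3 / κ (i3 j))) ∈ K := by
  obtain ⟨ρ1, hρ1, H⟩ := dens_exists hK (ι := ι × J × Fin 2 × Fin 2 × Fin 2)
    (fun x => s0 + κ x.1 * y0) (fun x => κ x.1) (fun x => h0 _) (fun x => hκ _)
    (show 0 < ε / 4 by positivity)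
  -- a uniform bound for the offsets, by continuity at zero
  have cont : ∀ᶠ v : ℝ × ℝ × ℝ × ℝ in nhds (0, 0, 0, 0), ∀ x : ι × J × Fin 2 × Fin 2 × Fin 2,
      |v.1 + x.2.2.1 * v.2.1 + x.2.2.2.1 * v.2.2.1 + x.2.2.2.2 * v.2.2.2 -
        κ x.1 * (x.2.2.1 * (v.2.1 / κ (i1 x.2.1)) + x.2.2.2.1 * (v.2.2.1 / κ (i2 x.2.1))
          + x.2.2.2.2 * (v.2.2.2 / κ (i3 x.2.1)))| < ρ1 ∧
      |x.2.2.1 * (v.2.1 / κ (i1 x.2.1)) + x.2.2.2.1 * (v.2.2.1 / κ (i2 x.2.1))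
          + x.2.2.2.2 * (v.2.2.2 / κ (i3 x.2.1))| < ε / 4 := by
    rw [Filter.eventually_all]
    intro x
    apply Filter.Eventually.and
    · refine ContinuousAt.eventually_lt (f := fun v : ℝ × ℝ × ℝ × ℝ => |v.1 + x.2.2.1 * v.2.1 + x.2.2.2.1 * v.2.2.1 + x.2.2.2.2 * v.2.2.2 -
        κ x.1 * (x.2.2.1 * (v.2.1 / κ (i1 x.2.1)) + x.2.2.2.1 * (v.2.2.1 / κ (i2 x.2.1))
          + x.2.2.2.2 * (v.2.2.2 / κ (i3 x.2.1)))|) ?_ continuousAt_const (by simpa using hρ1)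
      fun_prop
    · refine ContinuousAt.eventually_lt (f := fun v : ℝ × ℝ × ℝ × ℝ => |x.2.2.1 * (v.2.1 / κ (i1 x.2.1)) + x.2.2.2.1 * (v.2.2.1 / κ (i2 x.2.1))
          + x.2.2.2.2 * (v.2.2.2 / κ (i3 x.2.1))|) ?_ continuousAt_const (by simpa using hε)
      fun_prop
  obtain ⟨ρ, hρ, hball⟩ := Metric.eventually_nhds_iff.1 cont
  refine ⟨ρ, hρ, fun s u1 u2 u3 hs hu1 hu2 hu3 => ?_⟩
  have hv := @hball (s - s0, u1, u2, u3) (by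
    simp [Prod.dist_eq, Real.dist_eq, hs, hu1, hu2, hu3])
  obtain ⟨u, hu, hu'⟩ := H _ (fun x => (hv x).1)
  have main : ∀ j, ∀ e1 e2 e3 : Fin 2, ∀ i, s + e1 * u1 + e2 * u2 + e3 * u3 +
          κ i * (y0 + u - e1 * (u1 / κ (i1 j)) - e2 * (u2 / κ (i2 j)) - e3 * (u3 / κ (i3 j))) ∈ K := by
    intro j e1 e2 e3 i
    have := hu' (i, j, e1, e2, e3)
    convert this using 1
    simp only
    ring
  refine ⟨y0 + u, by simpa using hu.trans (by linarith), fun i => ?_, fun j e1 e2 e3 => ⟨?_, main j e1 e2 e3⟩⟩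
  · obtain ⟨j⟩ := ‹Nonempty J›
    simpa using main j 0 0 0 i
  · by_cases hι : Nonempty ι
    · obtain ⟨i⟩ := hι
      have := (hv (i, j, e1, e2, e3)).2
      simp only at this
      rw [abs_lt] at *
      constructor <;> linarith
    · exact absurd ⟨i1 j⟩ hι

lemma stage {φ : ℝ → ℝ} (hφ : Continuous φ) {K : Set ℝ} (hK : Dens K)
    (NQ : ∀ t ∈ K, ∀ ε > (0:ℝ), ∀ q p c : ℝ, ∃ u, |u - t| < ε ∧ φ u ≠ q * u ^ 2 + p * u + c)
    {ι J : Type} [Fintype ι] [Fintype J] (κ : ι → ℝ)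
    (hκ : ∀ i, κ i ≠ 0) (i1 i2 i3 : J → ι) (c1 c2 c3 d : J → ℝ)
    {O : Set (ℝ × ℝ)} (hO : IsOpen O) {s0 y0 : ℝ} (hs0 : (s0, y0) ∈ O) (h0 : s0 ∈ K)
    (h0' : ∀ i, s0 + κ i * y0 ∈ K) :
    ∃ s y, (s, y) ∈ O ∧ (∀ i, s + κ i * y ∈ K) ∧ ∀ j,
      φ s ≠ d j + c1 j * φ (s + κ (i1 j) * y) + c2 j * φ (s + κ (i2 j) * y)
        + c3 j * φ (s + κ (i3 j) * y) := by
  classical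
  set G : J → ℝ → ℝ → ℝ := fun j s y => d j + c1 j * φ (s + κ (i1 j) * y)
    + c2 j * φ (s + κ (i2 j) * y) + c3 j * φ (s + κ (i3 j) * y) with hG
  obtain ⟨⟨s1, y1⟩, O', hO', hOO, hp, hpZ, hdich⟩ := dichotomy
    (fun j (x : ℝ × ℝ) => φ x.1 - G j x.1 x.2) (fun j => by simp only [hG]; fun_prop)
    {x | x.1 ∈ K ∧ ∀ i, x.1 + κ i * x.2 ∈ K} O hO (s0, y0) hs0 ⟨h0, h0'⟩
  obtain ⟨hs1, hy1⟩ := hpZ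
  simp only at hs1 hy1
  let J' := {j : J // ∀ x ∈ O', x ∈ {x : ℝ × ℝ | x.1 ∈ K ∧ ∀ i, x.1 + κ i * x.2 ∈ K} → φ x.1 - G j x.1 x.2 = 0}
  by_cases hJ : Nonempty J'
  swap
  · refine ⟨s1, y1, hOO hp, hy1, fun j => ?_⟩
    rcases hdich j with h | h
    · exact sub_ne_zero.1 (h _ hp)
    · exact absurd ⟨⟨j, h⟩⟩ hJ
  obtain ⟨ε, hε, hεO⟩ := Metric.isOpen_iff.1 hO' _ hp
  have inO : ∀ s y, |s - s1| < ε → |y - y1| < ε → (s, y) ∈ O' := by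
    intro s y h1 h2
    apply hεO
    simp [Prod.dist_eq, Real.dist_eq, h1, h2]
  obtain ⟨ρ, hρ, hc⟩ := cube_lemma hK κ hκ (fun j : J' => i1 j.1) (fun j : J' => i2 j.1)
    (fun j : J' => i3 j.1) hy1 hε
  set w := min ρ (ε / 4) with hw
  have hw0 : 0 < w := by positivity
  have hwρ : w ≤ ρ := min_le_left _ _
  have hwε : w ≤ ε / 4 := min_le_right _ _
  have main : ∀ s u1 u2 u3, |s - s1| < w → |u1| < w → |u2| < w → |u3| < w →
      s + u1 ∈ K → s + u2 ∈ K → s + u3 ∈ K → s + u1 + u2 ∈ K → s + u1 + u3 ∈ K →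
      s + u2 + u3 ∈ K → s + u1 + u2 + u3 ∈ K →
      ∃ y, |y - y1| < ε ∧ (∀ i, s + κ i * y ∈ K) ∧ ∀ j : J',
        G j.1 s y = φ (s + u1) + φ (s + u2) + φ (s + u3) - φ (s + u1 + u2) - φ (s + u1 + u3)
        - φ (s + u2 + u3) + φ (s + u1 + u2 + u3) := by
    intro s u1 u2 u3 hs hu1 hu2 hu3 b1 b2 b3 b4 b5 b6 b7
    obtain ⟨y, hy, hyK, hyy⟩ := hc s u1 u2 u3 (by linarith) (by linarith) (by linarith) (by linarith)
    refine ⟨y, hy, hyK, fun j => ?_⟩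
    rw [alt_rhs φ _ _ _ _ _ _ _ (hκ (i1 j.1)) (hκ (i2 j.1)) (hκ (i3 j.1)) (G j.1)
      (fun _ _ => rfl) s y u1 u2 u3]
    have use : ∀ s' y', |s' - s1| < ε → s' ∈ K → |y' - y1| < ε → (∀ i, s' + κ i * y' ∈ K) →
        G j.1 s' y' = φ s' := by
      intro s' y' g1 g2 g3 g4
      have := j.2 (s', y') (inO _ _ g1 g3) ⟨g2, g4⟩
      simp only at this; linarith
    have k1 := hyy j 1 0 0
    have k2 := hyy j 0 1 0
    have k3 := hyy j 0 0 1
    have k4 := hyy j 1 1 0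
    have k5 := hyy j 1 0 1
    have k6 := hyy j 0 1 1
    have k7 := hyy j 1 1 1
    simp only [Fin.isValue, Fin.val_zero, Fin.val_one, Nat.cast_zero, Nat.cast_one, zero_mul, one_mul, sub_zero, add_zero] at k1 k2 k3 k4 k5 k6 k7
    rw [abs_lt] at hs hu1 hu2 hu3
    rw [use _ _ (by rw [abs_lt]; constructor <;> linarith) b1 k1.1 k1.2,
      use _ _ (by rw [abs_lt]; constructor <;> linarith) b2 k2.1 k2.2,
      use _ _ (by rw [abs_lt]; constructor <;> linarith) b3 k3.1 k3.2,
      use _ _ (by rw [abs_lt]; constructor <;> linarith) b4 k4.1 k4.2,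
      use _ _ (by rw [abs_lt]; constructor <;> linarith) b5 k5.1 k5.2,
      use _ _ (by rw [abs_lt]; constructor <;> linarith) b6 k6.1 k6.2,
      use _ _ (by rw [abs_lt]; constructor <;> linarith) b7 k7.1 k7.2]
  obtain ⟨M, hM⟩ := (isCompact_closedBall s1 w).exists_bound_of_continuousOn hφ.continuousOn
  obtain ⟨ρ3, hρ3, q, p, c, hquad⟩ := quad_on hK hs1 φ hw0
    (fun s hs => hM s (by simpa [Real.dist_eq] using hs.le)) (by
      intro s u1 u2 u3 hs hu1 hu2 hu3 b0 b1 b2 b3 b4 b5 b6 b7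
      obtain ⟨y, hy, hyK, hj⟩ := main s u1 u2 u3 hs hu1 hu2 hu3 b1 b2 b3 b4 b5 b6 b7
      obtain ⟨j⟩ := hJ
      rw [← hj j]
      have := j.2 (s, y) (inO _ _ (by linarith) hy) ⟨b0, hyK⟩
      simp only at this; linarith)
  obtain ⟨v, hv0, hvw, hvρ⟩ : ∃ v > (0:ℝ), 8 * v < w ∧ 8 * v < ρ3 :=
    ⟨min w ρ3 / 9, by positivity, by have := min_le_left w ρ3; linarith,
      by have := min_le_right w ρ3; linarith⟩
  obtain ⟨ρ4, hρ4, hd⟩ := dens_exists hK (fun _ : Fin 3 => s1) (fun i => (i:ℝ) + 1) (fun _ => hs1)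
    (fun i => by positivity) hv0
  obtain ⟨s, hs, hsne⟩ := NQ s1 hs1 (min ρ4 v) (by positivity) q p c
  have hs4 := hs.trans_le (min_le_left _ _)
  have hsv := hs.trans_le (min_le_right _ _)
  obtain ⟨u, hu, huK⟩ := hd (fun _ => s - s1) (fun _ => hs4)
  have a1 : s + u ∈ K := by have := huK 0; simp at this; convert this using 1; ring
  have a2 : s + u + u ∈ K := by have := huK 1; simp at this; convert this using 1; ring
  have a3 : s + u + u + u ∈ K := by have := huK 2; simp at this; convert this using 1; ring
  obtain ⟨y, hy, hyK, hj⟩ := main s u u u (by linarith) (by linarith) (by linarith) (by linarith)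
    a1 a1 a1 a2 a2 a2 a3
  rw [abs_lt] at hu hsv
  rw [hquad _ a1 (by rw [abs_lt]; constructor <;> linarith),
    hquad _ a2 (by rw [abs_lt]; constructor <;> linarith),
    hquad _ a3 (by rw [abs_lt]; constructor <;> linarith)] at hj
  have hin : (s, y) ∈ O' := inO _ _ (by rw [abs_lt]; constructor <;> linarith) hy
  refine ⟨s, y, hOO hin, hyK, fun j => ?_⟩
  rcases hdich j with h | h
  · exact sub_ne_zero.1 (h _ hin)
  · change φ s ≠ G j s y
    rw [hj ⟨j, h⟩]
    convert hsne using 1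
    ring

structure PRel where
  k : ℕ
  k1 : ℕ
  k2 : ℕ
  k3 : ℕ
  c1 : ℝ
  c2 : ℝ
  c3 : ℝ
  d : ℝ

def PRel.rhs (r : PRel) (φ : ℝ → ℝ) (x y : ℝ) : ℝ :=
  r.d + r.c1 * φ (x + r.k1 * y) + r.c2 * φ (x + r.k2 * y) + r.c3 * φ (x + r.k3 * y)

lemma key_NQ {φ : ℝ → ℝ} (hφ : Continuous φ) {K : Set ℝ} (hK : Dens K) (hne : K.Nonempty)
    {a b : ℝ} (hKab : K ⊆ Ioo a b)
    (NQ : ∀ t ∈ K, ∀ ε > (0:ℝ), ∀ q p c : ℝ, ∃ u, |u - t| < ε ∧ φ u ≠ q * u ^ 2 + p * u + c)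
    {J : Type} [Fintype J] (r : J → PRel) (M : ℕ)
    (hr : ∀ j, ((r j).k < (r j).k1 ∧ (r j).k1 ≤ M) ∧ ((r j).k < (r j).k2 ∧ (r j).k2 ≤ M) ∧
      ((r j).k < (r j).k3 ∧ (r j).k3 ≤ M)) :
    ∃ x y : ℝ, y ≠ 0 ∧ (∀ k : ℕ, k ≤ M → x + k * y ∈ Ioo a b) ∧
      ∀ j, φ (x + (r j).k * y) ≠ (r j).rhs φ x y := by
  classical
  suffices H : ∀ i : ℕ, i ≤ M + 1 → ∃ x y : ℝ, y ≠ 0 ∧ (∀ k : ℕ, k ≤ M → x + k * y ∈ Ioo a b) ∧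
      (∀ k : ℕ, i ≤ k → k ≤ M → x + k * y ∈ K) ∧
      ∀ j, (r j).k < i → φ (x + (r j).k * y) ≠ (r j).rhs φ x y by
    obtain ⟨x, y, h1, h2, -, h4⟩ := H (M + 1) le_rfl
    exact ⟨x, y, h1, h2, fun j => h4 j (by have := hr j; omega)⟩
  intro i
  induction i with
  | zero =>
    intro _
    obtain ⟨t, ht⟩ := hne
    obtain ⟨ρ, hρ, H⟩ := pick hK ht (M + 1) one_pos
    obtain ⟨s, -, hs⟩ := H (fun i => i * (ρ / (M + 1))) (by
      intro i
      have h1 : (i:ℝ) < M + 1 := by exact_mod_cast i.2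
      rw [abs_of_nonneg (by positivity), ← mul_div_assoc, div_lt_iff₀ (by positivity)]
      nlinarith)
    have hs' : ∀ k : ℕ, k ≤ M → s + k * (ρ / (M + 1)) ∈ K := by
      intro k hk
      simpa using hs ⟨k, by omega⟩
    exact ⟨s, ρ / (M + 1), by positivity, fun k hk => hKab (hs' k hk), fun k _ hk => hs' k hk,
      fun j hj => absurd hj (by omega)⟩
  | succ i ih =>
    intro hi
    obtain ⟨x0, y0, hy0, hab, hKK, hv⟩ := ih (by omega)
    set O : Set (ℝ × ℝ) := {z | z.2 ≠ 0} ∩ (⋂ k : Fin (M + 1), {z | z.1 - i * z.2 + (k:ℕ) * z.2 ∈ Ioo a b})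
      ∩ ⋂ j : {j : J // (r j).k < i}, {z | φ (z.1 - i * z.2 + (r j).k * z.2) ≠
          (r j).rhs φ (z.1 - i * z.2) z.2} with hO
    have hOo : IsOpen O := by
      refine ((isOpen_ne_fun continuous_snd continuous_const).inter
        (isOpen_iInter_of_finite fun k => ?_)).inter (isOpen_iInter_of_finite fun j => ?_)
      · exact isOpen_Ioo.preimage (by fun_prop)
      · apply isOpen_ne_fun
        · fun_prop
        · simp only [PRel.rhs]; fun_prop
    have e0 : x0 + i * y0 - i * y0 = x0 := by ring
    obtain ⟨s, y, hsO, hsK, hs⟩ := stage hφ hK NQ (ι := Finset.Ioc i M) (J := {j : J // (r j).k = i})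
      (fun k => ((k:ℕ):ℝ) - i) (fun k => by
        have := (Finset.mem_Ioc.1 k.2).1
        have : (i:ℝ) < (k:ℕ) := by exact_mod_cast this
        linarith)
      (fun j => ⟨(r j).k1, Finset.mem_Ioc.2 (by have := hr j; have := j.2; omega)⟩)
      (fun j => ⟨(r j).k2, Finset.mem_Ioc.2 (by have := hr j; have := j.2; omega)⟩)
      (fun j => ⟨(r j).k3, Finset.mem_Ioc.2 (by have := hr j; have := j.2; omega)⟩)
      (fun j => (r j).c1) (fun j => (r j).c2) (fun j => (r j).c3) (fun j => (r j).d)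
      hOo (s0 := x0 + i * y0) (y0 := y0) (by
        refine ⟨⟨hy0, mem_iInter.2 fun k => ?_⟩, mem_iInter.2 fun j => ?_⟩
        · simp only [mem_ofPred_eq, e0]; exact hab _ (by omega)
        · simp only [mem_ofPred_eq, e0]; exact hv _ j.2)
      (hKK i le_rfl (by omega)) (by
        intro k
        have hk := Finset.mem_Ioc.1 k.2
        have := hKK k hk.1.le hk.2
        convert this using 1; ring)
    obtain ⟨⟨hy, h2⟩, h3⟩ := hsO
    rw [mem_iInter] at h2 h3
    refine ⟨s - i * y, y, hy, fun k hk => ?_, fun k hk1 hk2 => ?_, fun j hj => ?_⟩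
    · exact h2 ⟨k, by omega⟩
    · have := hsK ⟨k, Finset.mem_Ioc.2 ⟨by omega, hk2⟩⟩
      convert this using 1
      simp only; ring
    · rcases Nat.lt_succ_iff_lt_or_eq.1 hj with h | h
      · exact h3 ⟨j, h⟩
      · have := hs ⟨j, h⟩
        simp only at this
        have e : ∀ k : ℕ, s - i * y + k * y = s + ((k:ℝ) - i) * y := by intro k; ring
        rw [PRel.rhs, e, e, e, e, h]
        simpa using this

lemma key_Q {φ : ℝ → ℝ} {a b t ε q p c : ℝ} (ht : t ∈ Ioo a b) (hε : 0 < ε) (hq : q ≠ 0)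
    (hquad : ∀ u, |u - t| < ε → φ u = q * u ^ 2 + p * u + c)
    {J : Type} [Fintype J] (r : J → PRel) (M : ℕ)
    (hr : ∀ j, ((r j).k < (r j).k1 ∧ (r j).k1 ≤ M) ∧ ((r j).k < (r j).k2 ∧ (r j).k2 ≤ M) ∧
      ((r j).k < (r j).k3 ∧ (r j).k3 ≤ M))
    (hnd : ∀ j, ¬ (1 = (r j).c1 + (r j).c2 + (r j).c3 ∧
      ((r j).k : ℝ) = (r j).c1 * (r j).k1 + (r j).c2 * (r j).k2 + (r j).c3 * (r j).k3 ∧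
      ((r j).k : ℝ) ^ 2 = (r j).c1 * (r j).k1 ^ 2 + (r j).c2 * (r j).k2 ^ 2 + (r j).c3 * (r j).k3 ^ 2)) :
    ∃ x y : ℝ, y ≠ 0 ∧ (∀ k : ℕ, k ≤ M → x + k * y ∈ Ioo a b) ∧
      ∀ j, φ (x + (r j).k * y) ≠ (r j).rhs φ x y := by
  classical
  set P : ℝ → ℝ := fun u => q * u ^ 2 + p * u + c with hP
  have hPc : Continuous P := by simp only [hP]; fun_prop
  set U : Set (ℝ × ℝ) := ⋂ k : Fin (M + 1), {z | z.1 + (k:ℕ) * z.2 ∈ Ioo a b ∩ Metric.ball t ε} with hU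
  have hUo : IsOpen U := isOpen_iInter_of_finite fun k =>
    (isOpen_Ioo.inter Metric.isOpen_ball).preimage (by fun_prop)
  have hU0 : (t, (0:ℝ)) ∈ U := mem_iInter.2 fun k => by
    simp only [mem_ofPred_eq, mul_zero, add_zero]
    exact ⟨ht, Metric.mem_ball_self hε⟩
  obtain ⟨⟨x, y⟩, O', hO', hsub, hp, -, hd⟩ := dichotomy (J := Option J)
    (fun o z => match o with
      | none => z.2
      | some j => P (z.1 + (r j).k * z.2) - (r j).rhs P z.1 z.2)
    (fun o => by
      cases o with
      | none => exact continuous_snd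
      | some j => simp only [PRel.rhs]; fun_prop) univ U hUo _ hU0 (mem_univ _)
  obtain ⟨δ, hδ, hball⟩ := Metric.isOpen_iff.1 hO' _ hp
  have inO : ∀ h k, |h| < δ → |k| < δ → (x + h, y + k) ∈ O' := by
    intro h k h1 h2
    apply hball
    simp [Prod.dist_eq, h1, h2]
  have hh : |δ/2| < δ := by rw [abs_of_pos (by positivity)]; linarith
  have hh' : |-(δ/2)| < δ := by rwa [abs_neg]
  have hz : |(0:ℝ)| < δ := by simpa
  have hx : (x, y) ∈ U := hsub hp
  rw [hU, mem_iInter] at hx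
  have hx' : ∀ k : ℕ, k ≤ M → x + k * y ∈ Ioo a b ∩ Metric.ball t ε := fun k hk => hx ⟨k, by omega⟩
  have hφP : ∀ k : ℕ, k ≤ M → φ (x + k * y) = P (x + k * y) := by
    intro k hk
    exact hquad _ (by simpa [Real.dist_eq] using (hx' k hk).2)
  refine ⟨x, y, ?_, fun k hk => (hx' k hk).1, fun j => ?_⟩
  · rcases hd none with h | h
    · exact h _ hp
    · have h1 := h _ (inO 0 0 hz hz) (mem_univ _)
      have h2 := h _ (inO 0 (δ/2) hz hh) (mem_univ _)
      simp only at h1 h2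
      linarith
  · have hrj := hr j
    have hPP : (r j).rhs φ x y = (r j).rhs P x y := by
      rw [PRel.rhs, PRel.rhs, hφP _ (by omega), hφP _ (by omega), hφP _ (by omega)]
    rw [hPP, hφP _ (by omega)]
    rcases hd (some j) with h | h
    · exact sub_ne_zero.1 (h _ hp)
    · exfalso
      have z0 := h _ (inO 0 0 hz hz) (mem_univ _)
      have z1 := h _ (inO (δ/2) 0 hh hz) (mem_univ _)
      have z2 := h _ (inO (-(δ/2)) 0 hh' hz) (mem_univ _)
      have z3 := h _ (inO 0 (δ/2) hz hh) (mem_univ _)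
      have z4 := h _ (inO 0 (-(δ/2)) hz hh') (mem_univ _)
      have z5 := h _ (inO (δ/2) (δ/2) hh hh) (mem_univ _)
      simp only [PRel.rhs, hP, add_zero] at z0 z1 z2 z3 z4 z5
      have nz : q * δ ^ 2 ≠ 0 := by positivity
      apply hnd j
      refine ⟨?_, ?_, ?_⟩
      · apply mul_left_cancel₀ nz
        linear_combination 2 * z1 - 4 * z0 + 2 * z2
      · apply mul_left_cancel₀ nz
        linear_combination 2 * z5 - 2 * z1 - 2 * z3 + 2 * z0
      · apply mul_left_cancel₀ nz
        linear_combination 2 * z3 - 4 * z0 + 2 * z4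

lemma key_main {φ : ℝ → ℝ} (hφ : Continuous φ) {K : Set ℝ} (hK : Dens K) (hne : K.Nonempty)
    {a b : ℝ} (hKab : K ⊆ Ioo a b)
    (NA : ∀ t ∈ K, ∀ ε > (0:ℝ), ∀ p c : ℝ, ∃ u, |u - t| < ε ∧ φ u ≠ p * u + c)
    {J : Type} [Fintype J] (r : J → PRel) (M : ℕ)
    (hr : ∀ j, ((r j).k < (r j).k1 ∧ (r j).k1 ≤ M) ∧ ((r j).k < (r j).k2 ∧ (r j).k2 ≤ M) ∧
      ((r j).k < (r j).k3 ∧ (r j).k3 ≤ M))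
    (hnd : ∀ j, ¬ (1 = (r j).c1 + (r j).c2 + (r j).c3 ∧
      ((r j).k : ℝ) = (r j).c1 * (r j).k1 + (r j).c2 * (r j).k2 + (r j).c3 * (r j).k3 ∧
      ((r j).k : ℝ) ^ 2 = (r j).c1 * (r j).k1 ^ 2 + (r j).c2 * (r j).k2 ^ 2 + (r j).c3 * (r j).k3 ^ 2)) :
    ∃ x y : ℝ, y ≠ 0 ∧ (∀ k : ℕ, k ≤ M → x + k * y ∈ Ioo a b) ∧
      ∀ j, φ (x + (r j).k * y) ≠ (r j).rhs φ x y := by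
  by_cases NQ : ∀ t ∈ K, ∀ ε > (0:ℝ), ∀ q p c : ℝ, ∃ u, |u - t| < ε ∧ φ u ≠ q * u ^ 2 + p * u + c
  · exact key_NQ hφ hK hne hKab NQ r M hr
  · push Not at NQ
    obtain ⟨t, ht, ε, hε, q, p, c, h⟩ := NQ
    refine key_Q (hKab ht) hε ?_ h r M hr hnd
    rintro rfl
    obtain ⟨u, hu, hne⟩ := NA t ht ε hε p c
    exact hne (by rw [h u hu]; ring)

def PS (φ : ℝ → ℝ) (A : Set ℝ) : Prop :=
  ∀ a₁ ∈ A, ∀ a₂ ∈ A, ∀ a₃ ∈ A, ∀ a₄ ∈ A, φ a₁ + φ a₂ = φ a₃ + φ a₄ →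
    (a₁ = a₃ ∧ a₂ = a₄) ∨ (a₁ = a₄ ∧ a₂ = a₃)

def fidx {A : Finset ℝ} {N : ℕ} : A ⊕ Fin (N + 1) → ℕ
  | Sum.inl _ => N + 1
  | Sum.inr k => k

def fwt {A : Finset ℝ} {N : ℕ} : A ⊕ Fin (N + 1) → ℝ
  | Sum.inl _ => 0
  | Sum.inr _ => 1

def fcst {A : Finset ℝ} {N : ℕ} (φ : ℝ → ℝ) : A ⊕ Fin (N + 1) → ℝ
  | Sum.inl a => φ a
  | Sum.inr _ => 0

def fpt {A : Finset ℝ} {N : ℕ} (x y : ℝ) : A ⊕ Fin (N + 1) → ℝ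
  | Sum.inl a => a
  | Sum.inr k => x + (k : ℕ) * y

lemma fval {A : Finset ℝ} {N : ℕ} (φ : ℝ → ℝ) (x y : ℝ) (e : A ⊕ Fin (N + 1)) :
    φ (fpt x y e) = fcst φ e + fwt e * φ (x + fidx e * y) := by
  cases e <;> simp [fpt, fcst, fwt, fidx]

lemma fidx_le {A : Finset ℝ} {N : ℕ} (e : A ⊕ Fin (N + 1)) : fidx e ≤ N + 1 := by
  cases e with
  | inl a => simp [fidx]
  | inr k => simp only [fidx]; omega

lemma fwt_cases {A : Finset ℝ} {N : ℕ} (e : A ⊕ Fin (N + 1)) : fwt e = 0 ∨ fwt e = 1 := by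
  cases e <;> simp [fwt]

lemma extend {φ : ℝ → ℝ} (hφ : Continuous φ) {K : Set ℝ} (hK : Dens K) (hne : K.Nonempty)
    {a b : ℝ} (hKab : K ⊆ Ioo a b)
    (NA : ∀ t ∈ K, ∀ ε > (0:ℝ), ∀ p c : ℝ, ∃ u, |u - t| < ε ∧ φ u ≠ p * u + c)
    (A : Finset ℝ) (hA : PS φ A) (N : ℕ) :
    ∃ x y : ℝ, y ≠ 0 ∧ (∀ k : ℕ, k ≤ N → x + k * y ∈ Ioo a b) ∧
      PS φ (A ∪ {z | ∃ k : ℕ, k ≤ N ∧ z = x + k * y}) := by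
  classical
  let E := A ⊕ Fin (N + 1)
  let J := {t : Bool × Fin (N + 1) × E × E × E // (t.2.1 : ℕ) < fidx t.2.2.1 ∧
    (t.2.1 : ℕ) < fidx t.2.2.2.1 ∧ (t.2.1 : ℕ) < fidx t.2.2.2.2}
  let r : J → PRel := fun j =>
    { k := j.1.2.1
      k1 := fidx j.1.2.2.1
      k2 := fidx j.1.2.2.2.1
      k3 := fidx j.1.2.2.2.2
      c1 := if j.1.1 then - fwt j.1.2.2.1 else 0
      c2 := if j.1.1 then fwt j.1.2.2.2.1 else fwt j.1.2.2.2.1 / 2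
      c3 := if j.1.1 then fwt j.1.2.2.2.2 else fwt j.1.2.2.2.2 / 2
      d := if j.1.1 then fcst φ j.1.2.2.2.1 + fcst φ j.1.2.2.2.2 - fcst φ j.1.2.2.1
        else (fcst φ j.1.2.2.2.1 + fcst φ j.1.2.2.2.2) / 2 }
  obtain ⟨x, y, hy, hin, hviol⟩ := key_main hφ hK hne hKab NA r (N + 1)
    (by
      rintro ⟨⟨B, k, e2, e3, e4⟩, h1, h2, h3⟩
      exact ⟨⟨h1, fidx_le _⟩, ⟨h2, fidx_le _⟩, ⟨h3, fidx_le _⟩⟩)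
    (by
      rintro ⟨⟨B, k, e2, e3, e4⟩, h1, h2, h3⟩ ⟨m0, m1, m2⟩
      simp only [r] at m0 m1 m2 h1 h2 h3
      have g1 : ((k:ℕ):ℝ) < (fidx e2 : ℕ) := by exact_mod_cast h1
      have g2 : ((k:ℕ):ℝ) < (fidx e3 : ℕ) := by exact_mod_cast h2
      have g3 : ((k:ℕ):ℝ) < (fidx e4 : ℕ) := by exact_mod_cast h3
      generalize ((fidx e2 : ℕ) : ℝ) = k2 at *
      generalize ((fidx e3 : ℕ) : ℝ) = k3 at *
      generalize ((fidx e4 : ℕ) : ℝ) = k4 at *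
      generalize ((k : ℕ) : ℝ) = k1 at *
      cases B
      · rcases fwt_cases e3 with w3 | w3 <;> rcases fwt_cases e4 with w4 | w4 <;>
          simp only [w3, w4] at m0 m1 m2 <;>
          first | (norm_num at m0; done) | (norm_num at m1 m2)
        linarith
      · rcases fwt_cases e2 with w2 | w2 <;> rcases fwt_cases e3 with w3 | w3 <;>
          rcases fwt_cases e4 with w4 | w4 <;>
          simp only [w2, w3, w4] at m0 m1 m2 <;>
          first | (norm_num at m0; done) | (norm_num at m1 m2)
        · linarith
        · linarith
        · have e : k2 = k3 + k4 - k1 := by linarith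
          subst e
          have : (k3 - k1) * (k4 - k1) = 0 := by nlinarith
          rcases mul_eq_zero.1 this with h | h <;> linarith)
  refine ⟨x, y, hy, fun k hk => hin k (by omega), ?_⟩
  let v : E → ℝ := fun e => φ (fpt x y e)
  have F1 : ∀ (k : Fin (N + 1)) (e2 e3 e4 : E), (k:ℕ) < fidx e2 → (k:ℕ) < fidx e3 → (k:ℕ) < fidx e4 →
      v (Sum.inr k) + v e2 ≠ v e3 + v e4 := by
    intro k e2 e3 e4 h2 h3 h4 heq
    apply hviol ⟨⟨true, k, e2, e3, e4⟩, h2, h3, h4⟩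
    simp only [v, fval φ x y e2, fval φ x y e3, fval φ x y e4] at heq
    simp only [fpt] at heq
    simp only [r, PRel.rhs, if_true]
    linarith
  have F2 : ∀ (k : Fin (N + 1)) (e3 e4 : E), (k:ℕ) < fidx e3 → (k:ℕ) < fidx e4 →
      v (Sum.inr k) + v (Sum.inr k) ≠ v e3 + v e4 := by
    intro k e3 e4 h3 h4 heq
    apply hviol ⟨⟨false, k, e3, e3, e4⟩, h3, h3, h4⟩
    simp only [v, fval φ x y e3, fval φ x y e4] at heq
    simp only [fpt] at heq
    simp only [r, PRel.rhs, Bool.false_eq_true, if_false]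
    linarith
  have idxinj : ∀ (k : Fin (N+1)) (e : E), (k:ℕ) ≤ fidx e → e ≠ Sum.inr k → (k:ℕ) < fidx e := by
    intro k e h1 h2
    rcases e with e | e
    · simp only [fidx]; omega
    · simp only [fidx] at h1 ⊢
      rcases h1.lt_or_eq with h | h
      · exact h
      · exact absurd (congrArg Sum.inr (Fin.ext h.symm)) h2
  have I0 : ∀ e e' : E, fidx e ≤ fidx e' → v e = v e' → e = e' := by
    intro e e' hle hv
    by_contra hcon
    rcases e with e | k
    · rcases e' with e' | k'
      · have := hA e e.2 e e.2 e' e'.2 e' e'.2 (by simp only [v, fpt] at hv; rw [hv])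
        apply hcon
        rcases this with h | h <;> exact congrArg Sum.inl (Subtype.ext h.1)
      · simp only [fidx] at hle; omega
    · have := idxinj k e' hle (fun h => hcon h.symm)
      exact F1 k e' e' e' this this this (by rw [hv])
  have I : ∀ e e' : E, v e = v e' → e = e' := by
    intro e e' hv
    rcases le_total (fidx e) (fidx e') with h | h
    · exact I0 e e' h hv
    · exact (I0 e' e h hv.symm).symm
  have L : ∀ e1 e2 e3 e4 : E, fidx e1 ≤ fidx e2 → fidx e1 ≤ fidx e3 → fidx e1 ≤ fidx e4 →
      e1 ≠ e3 → e1 ≠ e4 → v e1 + v e2 = v e3 + v e4 → False := by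
    intro e1 e2 e3 e4 h2 h3 h4 n3 n4 hv
    rcases e1 with e1 | k
    · rcases e2 with e2 | k2
      swap
      · simp only [fidx] at h2; omega
      rcases e3 with e3 | k3
      swap
      · simp only [fidx] at h3; omega
      rcases e4 with e4 | k4
      swap
      · simp only [fidx] at h4; omega
      rcases hA e1 e1.2 e2 e2.2 e3 e3.2 e4 e4.2 hv with h | h
      · exact n3 (congrArg Sum.inl (Subtype.ext h.1))
      · exact n4 (congrArg Sum.inl (Subtype.ext h.1))
    · have g3 := idxinj k e3 h3 n3.symm
      have g4 := idxinj k e4 h4 n4.symm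
      by_cases h : e2 = Sum.inr k
      · subst h
        exact F2 k e3 e4 g3 g4 hv
      · exact F1 k e2 e3 e4 (idxinj k e2 h2 h) g3 g4 hv
  have II : ∀ e1 e2 e3 e4 : E, v e1 + v e2 = v e3 + v e4 → (e1 = e3 ∧ e2 = e4) ∨ (e1 = e4 ∧ e2 = e3) := by
    intro e1 e2 e3 e4 hv
    by_cases c13 : e1 = e3
    · subst c13; exact Or.inl ⟨rfl, I _ _ (by linarith)⟩
    by_cases c14 : e1 = e4
    · subst c14; exact Or.inr ⟨rfl, I _ _ (by linarith)⟩
    by_cases c23 : e2 = e3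
    · subst c23; exact Or.inr ⟨I _ _ (by linarith), rfl⟩
    by_cases c24 : e2 = e4
    · subst c24; exact Or.inl ⟨I _ _ (by linarith), rfl⟩
    exfalso
    have l1 := L e1 e2 e3 e4
    have l2 := L e2 e1 e3 e4
    have l3 := L e3 e4 e1 e2
    have l4 := L e4 e3 e1 e2
    by_cases m1 : fidx e1 ≤ fidx e2 ∧ fidx e1 ≤ fidx e3 ∧ fidx e1 ≤ fidx e4
    · exact l1 m1.1 m1.2.1 m1.2.2 c13 c14 hv
    by_cases m2 : fidx e2 ≤ fidx e1 ∧ fidx e2 ≤ fidx e3 ∧ fidx e2 ≤ fidx e4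
    · exact l2 m2.1 m2.2.1 m2.2.2 c23 c24 (by linarith)
    by_cases m3 : fidx e3 ≤ fidx e4 ∧ fidx e3 ≤ fidx e1 ∧ fidx e3 ≤ fidx e2
    · exact l3 m3.1 m3.2.1 m3.2.2 (Ne.symm c13) (Ne.symm c23) (by linarith)
    · exact l4 (by omega) (by omega) (by omega) (Ne.symm c14) (Ne.symm c24) (by linarith)
  have surj : ∀ z ∈ (A : Set ℝ) ∪ {z | ∃ k : ℕ, k ≤ N ∧ z = x + k * y}, ∃ e : E, fpt x y e = z := by
    rintro z (hz | ⟨k, hk, rfl⟩)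
    · exact ⟨Sum.inl ⟨z, hz⟩, rfl⟩
    · exact ⟨Sum.inr ⟨k, by omega⟩, rfl⟩
  intro a1 h1 a2 h2 a3 h3 a4 h4 hv
  obtain ⟨e1, rfl⟩ := surj a1 h1
  obtain ⟨e2, rfl⟩ := surj a2 h2
  obtain ⟨e3, rfl⟩ := surj a3 h3
  obtain ⟨e4, rfl⟩ := surj a4 h4
  rcases II e1 e2 e3 e4 hv with ⟨rfl, rfl⟩ | ⟨rfl, rfl⟩
  · exact Or.inl ⟨rfl, rfl⟩
  · exact Or.inr ⟨rfl, rfl⟩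

lemma dens_set {F : Set ℝ} (hF : MeasurableSet F) (h0 : volume F ≠ 0) :
    ∃ K ⊆ F, K.Nonempty ∧ Dens K := by
  let K : Set ℝ := {t ∈ F | ∀ η > (0:ℝ), ∃ r0 > (0:ℝ), ∀ r, 0 < r → r < r0 →
    volume (Metric.ball t r \ F) ≤ ENNReal.ofReal (η * r)}
  have hnull : volume (F \ K) = 0 := by
    have h := Besicovitch.ae_tendsto_measure_inter_div_of_measurableSet (volume : Measure ℝ) hF.compl
    refine measure_mono_null ?_ (ae_iff.1 h)
    rintro t ⟨htF, htK⟩ hT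
    apply htK
    refine ⟨htF, fun η hη => ?_⟩
    have hi : (Fᶜ).indicator (1 : ℝ → ENNReal) t = 0 := by simp [htF]
    rw [hi] at hT
    have hev := hT.eventually (gt_mem_nhds (show (0:ENNReal) < ENNReal.ofReal (η / 2) by
      simpa using hη))
    rw [eventually_nhdsWithin_iff, Metric.eventually_nhds_iff] at hev
    obtain ⟨r0, hr0, hr⟩ := hev
    refine ⟨r0, hr0, fun r hrp hrr => ?_⟩
    have h1 := hr (y := r) (by simpa [abs_of_pos hrp] using hrr) hrp
    rw [Real.volume_closedBall] at h1
    have h2 : volume (Fᶜ ∩ Metric.closedBall t r) ≤ ENNReal.ofReal (η / 2) * ENNReal.ofReal (2 * r) := by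
      rw [← ENNReal.div_le_iff (by simpa using hrp) ENNReal.ofReal_ne_top]
      exact h1.le
    rw [← ENNReal.ofReal_mul (by positivity)] at h2
    refine (measure_mono ?_).trans (h2.trans (le_of_eq (by congr 1; ring)))
    rintro z ⟨hz1, hz2⟩
    exact ⟨hz2, Metric.ball_subset_closedBall hz1⟩
  refine ⟨K, fun t ht => ht.1, ?_, ?_⟩
  · by_contra hne
    rw [Set.not_nonempty_iff_eq_empty] at hne
    rw [hne, Set.sdiff_empty] at hnull
    exact h0 hnull
  · intro t ht η hη
    obtain ⟨r0, hr0, h⟩ := ht.2 η hη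
    refine ⟨r0, hr0, fun r h1 h2 => le_trans ?_ (h r h1 h2)⟩
    calc volume (Metric.ball t r \ K) ≤ volume ((Metric.ball t r \ F) ∪ (F \ K)) := by
          apply measure_mono
          rintro z ⟨hz1, hz2⟩
          by_cases hz : z ∈ F
          · exact Or.inr ⟨hz, hz2⟩
          · exact Or.inl ⟨hz1, hz⟩
      _ ≤ _ := (measure_union_le _ _).trans (by rw [hnull, add_zero])

lemma PS_union (φ : ℝ → ℝ) (a b : ℝ)
    (step : ∀ (A : Finset ℝ), PS φ A → ∀ N : ℕ, ∃ x y : ℝ, y ≠ 0 ∧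
      (∀ k : ℕ, k ≤ N → x + k * y ∈ Ioo a b) ∧ PS φ (A ∪ {z | ∃ k : ℕ, k ≤ N ∧ z = x + k * y})) :
    ∃ A : Set ℝ, A ⊆ Icc a b ∧ PS φ A ∧ ∀ N : ℕ, ∃ x y : ℝ, y ≠ 0 ∧
      ∀ k : ℕ, k ≤ N → x + (k:ℝ) * y ∈ A := by
  classical
  have step2 : ∀ (N : ℕ) (A : {A : Finset ℝ // PS φ A ∧ (A : Set ℝ) ⊆ Icc a b}),
      ∃ A' : {A : Finset ℝ // PS φ A ∧ (A : Set ℝ) ⊆ Icc a b}, A.1 ⊆ A'.1 ∧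
        ∃ x y : ℝ, y ≠ 0 ∧ ∀ k : ℕ, k ≤ N → x + (k:ℝ) * y ∈ A'.1 := by
    rintro N ⟨A, hA, hAs⟩
    obtain ⟨x, y, hy, hin, hPS⟩ := step A hA N
    have e : ((A ∪ (Finset.range (N+1)).image (fun k : ℕ => x + (k:ℝ) * y) : Finset ℝ) : Set ℝ)
        = (A : Set ℝ) ∪ {z : ℝ | ∃ k : ℕ, k ≤ N ∧ z = x + k * y} := by
      ext z
      simp [Nat.lt_succ_iff, eq_comm]
    refine ⟨⟨A ∪ (Finset.range (N+1)).image (fun k : ℕ => x + (k:ℝ) * y), ?_, ?_⟩,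
      Finset.subset_union_left, x, y, hy, ?_⟩
    · rw [e]; exact hPS
    · rw [e]
      rintro z (hz | ⟨k, hk, rfl⟩)
      · exact hAs hz
      · exact Ioo_subset_Icc_self (hin k hk)
    · intro k hk
      apply Finset.mem_union_right
      exact Finset.mem_image_of_mem _ (Finset.mem_range.2 (by omega))
  choose nxt hsub hap using step2
  let S : ℕ → {A : Finset ℝ // PS φ A ∧ (A : Set ℝ) ⊆ Icc a b} := fun n =>
    Nat.rec ⟨∅, by intro a₁ h; simp at h, by simp⟩ (fun n A => nxt n A) n
  have hS : ∀ n, S (n+1) = nxt n (S n) := fun n => rfl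
  have hmono : Monotone (fun n => (S n).1) :=
    monotone_nat_of_le_succ (fun n => by rw [hS]; exact hsub n (S n))
  refine ⟨⋃ n, ((S n).1 : Set ℝ), ?_, ?_, ?_⟩
  · exact iUnion_subset fun n => (S n).2.2
  · intro a₁ h1 a₂ h2 a₃ h3 a₄ h4
    obtain ⟨n1, h1⟩ := mem_iUnion.1 h1
    obtain ⟨n2, h2⟩ := mem_iUnion.1 h2
    obtain ⟨n3, h3⟩ := mem_iUnion.1 h3
    obtain ⟨n4, h4⟩ := mem_iUnion.1 h4
    exact (S (n1 + n2 + n3 + n4)).2.1 a₁ (hmono (by omega : n1 ≤ n1 + n2 + n3 + n4) h1)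
      a₂ (hmono (by omega : n2 ≤ n1 + n2 + n3 + n4) h2)
      a₃ (hmono (by omega : n3 ≤ n1 + n2 + n3 + n4) h3)
      a₄ (hmono (by omega : n4 ≤ n1 + n2 + n3 + n4) h4)
  · intro N
    obtain ⟨x, y, hy, h⟩ := hap N (S N)
    refine ⟨x, y, hy, fun k hk => mem_iUnion.2 ⟨N + 1, ?_⟩⟩
    rw [hS]
    exact h k hk

theorem interval_version (a b : ℝ) (hab : a < b) (φ : ℝ → ℝ)
    (hφ : ContinuousOn φ (Set.Icc a b))
    (hE : volume {t ∈ Set.Ioo a b |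
      ¬ ∃ ε > (0 : ℝ), ∃ p q : ℝ,
        ∀ u ∈ Set.Icc a b, |u - t| < ε → φ u = p * u + q} ≠ 0) :
    ∃ A B : Set ℝ, A ⊆ Set.Icc a b ∧
      (∀ N : ℕ, 1 ≤ N → ∃ x y : ℝ, y ≠ 0 ∧
        ∀ k ∈ Finset.Icc 1 N, x + (k : ℝ) * y ∈ A) ∧
      DistinctSumsOfPairs B ∧
      Set.BijOn φ A B := by
  let ψ : ℝ → ℝ := IccExtend hab.le (domRestrict (Icc a b) φ)
  have hψ : Continuous ψ := (hφ.domRestrict).Icc_extend'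
  have hag : ∀ u ∈ Icc a b, ψ u = φ u := fun u hu => IccExtend_of_mem hab.le _ hu
  let G : Set ℝ := {t | ∃ ε > (0 : ℝ), ∃ p q : ℝ,
        ∀ u ∈ Set.Icc a b, |u - t| < ε → φ u = p * u + q}
  have hG : IsOpen G := by
    rw [Metric.isOpen_iff]
    rintro t ⟨ε, hε, p, q, h⟩
    refine ⟨ε / 2, by positivity, fun s hs => ⟨ε / 2, by positivity, p, q, fun u hu hus => h u hu ?_⟩⟩
    rw [Metric.mem_ball, Real.dist_eq] at hs
    have := abs_sub_le u s t
    linarith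
  have hF : MeasurableSet (Ioo a b ∩ Gᶜ) := measurableSet_Ioo.inter hG.measurableSet.compl
  obtain ⟨K, hKF, hKne, hKd⟩ := dens_set hF hE
  have NA : ∀ t ∈ K, ∀ ε > (0:ℝ), ∀ p c : ℝ, ∃ u, |u - t| < ε ∧ ψ u ≠ p * u + c := by
    intro t ht ε hε p c
    by_contra! hc
    exact (hKF ht).2 ⟨ε, hε, p, c, fun u hu hut => by rw [← hag u hu]; exact hc u hut⟩
  obtain ⟨A, hAs, hPS, hAP⟩ := PS_union ψ a b
    (fun A hA N => extend hψ hKd hKne (fun t ht => (hKF ht).1) NA A hA N)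
  have hPS2 : PS φ A := by
    intro a₁ h1 a₂ h2 a₃ h3 a₄ h4 h
    apply hPS a₁ h1 a₂ h2 a₃ h3 a₄ h4
    rw [hag _ (hAs h1), hag _ (hAs h2), hag _ (hAs h3), hag _ (hAs h4), h]
  refine ⟨A, φ '' A, hAs, ?_, ?_, ?_⟩
  · intro N _
    obtain ⟨x, y, hy, h⟩ := hAP N
    exact ⟨x, y, hy, fun k hk => h k (Finset.mem_Icc.1 hk).2⟩
  · rintro _ ⟨a₁, h1, rfl⟩ _ ⟨a₂, h2, rfl⟩ _ ⟨a₃, h3, rfl⟩ _ ⟨a₄, h4, rfl⟩ h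
    rcases hPS2 a₁ h1 a₂ h2 a₃ h3 a₄ h4 h with ⟨rfl, rfl⟩ | ⟨rfl, rfl⟩
    · exact Or.inl ⟨rfl, rfl⟩
    · exact Or.inr ⟨rfl, rfl⟩
  · apply InjOn.bijOn_image
    intro s hs t ht h
    rcases hPS2 s hs s hs t ht t ht (by rw [h]) with ⟨h, _⟩ | ⟨h, _⟩ <;> exact h
end
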